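/- arXiv:2305.11829 — 2 statements merged into one kernel-verified Lean document; each statement's English description precedes it below -/
import Mathlib

section
/- Let Φ_E be a regular Gauss IFS whose conformal measure μ satisfies Assumption C with constant λ > 1, and define W_k with this λ. Given subsets J_k ⊆ E for each k, let A_k = ⋃{[ωa] : ω ∈ W_k, a ∈ J_k}. Then the sequence (A_k) is quasi-independent: there is a constant C > 0 (independent of the J_k) such that μ(A_k ∩ A_ℓ) ≤ C·μ(A_k)·μ(A_ℓ) whenever k ≠ ℓ. -/
open MeasureTheory Metric Filter Set
open scoped ENNReal Topology NNReal

noncomputable section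

/-- The Gauss map `φ_a(x) = 1/(a+x)`. -/
def gaussMap (a : ℕ) (x : ℝ) : ℝ := 1 / (a + x)

/-- `φ_ω = φ_{ω₁} ∘ ⋯ ∘ φ_{ω_n}` for a finite word `ω`. -/
def wordMap : List ℕ → ℝ → ℝ
  | [] => fun x => x
  | a :: ω => fun x => gaussMap a (wordMap ω x)

/-- `‖φ_ω'‖ = sup_{x ∈ [0,1]} |φ_ω'(x)|`. -/
def derivNorm (ω : List ℕ) : ℝ := ⨆ x : Icc (0 : ℝ) 1, |deriv (wordMap ω) (x : ℝ)|

/-- The cylinder `[ω] = φ_ω([0,1])`. -/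
def cyl (ω : List ℕ) : Set ℝ := wordMap ω '' Icc 0 1

/-- The set of finite words over the alphabet `E`. -/
def words (E : Set ℕ) : Set (List ℕ) := {ω | ∀ a ∈ ω, a ∈ E}

/-- The coding map `π(ω) = [0; ω₀, ω₁, …]`. -/
def codingMap (ω : ℕ → ℕ) : ℝ :=
  limUnder atTop fun n => wordMap (List.ofFn fun i : Fin n => ω i) 0

/-- The limit set `Λ_E`. -/
def limitSet (E : Set ℕ) : Set ℝ := codingMap '' {ω | ∀ n, ω n ∈ E}

/-- The pressure function of the Gauss IFS on the alphabet `E`. -/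
def pressure (E : Set ℕ) (s : ℝ) : ℝ :=
  limUnder atTop fun n : ℕ =>
    (n : ℝ)⁻¹ * Real.log (∑' ω : Fin n → E, derivNorm (List.ofFn fun i => (ω i : ℕ)) ^ s)

/-- `μ` is the `δ`-conformal measure of the Gauss IFS on the alphabet `E`. -/
def IsConformal (E : Set ℕ) (δ : ℝ) (μ : Measure ℝ) : Prop :=
  IsProbabilityMeasure μ ∧ μ (limitSet E)ᶜ = 0 ∧
    ∀ A : Set ℝ, A ⊆ Icc 0 1 → MeasurableSet A →
      μ A = ∑' a : E, ENNReal.ofReal (∫ x in gaussMap (a : ℕ) ⁻¹' A, |deriv (gaussMap (a : ℕ)) x| ^ δ ∂μ)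

/-- The set of prime numbers. -/
def primes : Set ℕ := {p | p.Prime}

/-- `μ(J) = ∑_{a ∈ J} μ([a])` for a set of letters `J`. -/
def cylMass (μ : Measure ℝ) (J : Set ℕ) : ℝ≥0∞ := ∑' a : J, μ (cyl [(a : ℕ)])

/-- A dimension function: continuous, increasing, positive, with `ψ(0⁺) = 0`. -/
def IsDimFun (ψ : ℝ → ℝ) : Prop :=
  ContinuousOn ψ (Ioi 0) ∧ MonotoneOn ψ (Ioi 0) ∧ (∀ r : ℝ, 0 < r → 0 < ψ r) ∧
    Tendsto ψ (𝓝[>] (0 : ℝ)) (𝓝 0)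

/-- A doubling function. -/
def IsDoubling (ψ : ℝ → ℝ) : Prop :=
  ∀ C₁ : ℝ, 1 ≤ C₁ → ∃ C₂ : ℝ, 1 ≤ C₂ ∧ ∀ x y : ℝ, 0 < x → 0 < y →
    C₁⁻¹ ≤ x / y → x / y ≤ C₁ → C₂⁻¹ ≤ ψ x / ψ y ∧ ψ x / ψ y ≤ C₂

open Classical in
/-- The `ψ`-dimensional Hausdorff measure `H^ψ`. -/
def hausdorffPsi (ψ : ℝ → ℝ) : Measure ℝ :=
  Measure.mkMetric fun d => if d = 0 then 0 else ENNReal.ofReal (ψ d.toReal)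

/-- `H^ψ(μ) = inf {H^ψ(A) : A Borel, μ(ℝ∖A) = 0}`. -/
def hausdorffPsiOf (ψ : ℝ → ℝ) (μ : Measure ℝ) : ℝ≥0∞ :=
  ⨅ (A : Set ℝ) (_ : MeasurableSet A) (_ : μ Aᶜ = 0), hausdorffPsi ψ A

/-- The `ψ`-dimensional packing pre-measure `P̃^ψ`. -/
def packingPre (ψ : ℝ → ℝ) (A : Set ℝ) : ℝ≥0∞ :=
  ⨅ (ε : ℝ) (_ : 0 < ε),
    ⨆ (D : Set (ℝ × ℝ)) (_ : D.Countable)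
      (_ : ∀ p ∈ D, p.1 ∈ A ∧ 0 < p.2 ∧ 2 * p.2 ≤ ε)
      (_ : D.PairwiseDisjoint fun p => closedBall p.1 p.2),
      ∑' p : D, ENNReal.ofReal (ψ (2 * (p : ℝ × ℝ).2))

/-- The `ψ`-dimensional packing measure `P^ψ`. -/
def packingPsi (ψ : ℝ → ℝ) (A : Set ℝ) : ℝ≥0∞ :=
  ⨅ (S : ℕ → Set ℝ) (_ : A ⊆ ⋃ i, S i), ∑' i, packingPre ψ (S i)

/-- `P^ψ(μ) = inf {P^ψ(A) : A Borel, μ(ℝ∖A) = 0}`. -/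
def packingPsiOf (ψ : ℝ → ℝ) (μ : Measure ℝ) : ℝ≥0∞ :=
  ⨅ (A : Set ℝ) (_ : MeasurableSet A) (_ : μ Aᶜ = 0), packingPsi ψ A

/-- Assumption C with constant `λ`: `μ({a : λ⁻¹r < ‖φ_a'‖ ≤ r}) ≍ μ({a : ‖φ_a'‖ ≤ r})`. -/
def AssumptionC (E : Set ℕ) (μ : Measure ℝ) (lam : ℝ) : Prop :=
  ∃ c C : ℝ≥0∞, 0 < c ∧ C ≠ ⊤ ∧ ∀ r : ℝ, 0 < r → r ≤ 1 →
    c * cylMass μ {a ∈ E | derivNorm [a] ≤ r} ≤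
        cylMass μ {a ∈ E | lam⁻¹ * r < derivNorm [a] ∧ derivNorm [a] ≤ r} ∧
      cylMass μ {a ∈ E | lam⁻¹ * r < derivNorm [a] ∧ derivNorm [a] ≤ r} ≤
        C * cylMass μ {a ∈ E | derivNorm [a] ≤ r}

/-- `f` is regularly varying with exponent `s`. -/
def RegVarying (f : ℝ → ℝ) (s : ℝ) : Prop :=
  ∀ a : ℝ, 1 < a → Tendsto (fun x => f (a * x) / f x) atTop (𝓝 (a ^ s))

/-- Assumption 1: `#(E ∩ [N,2N]) ≍ f(N)`. -/
def Assumption1 (E : Set ℕ) (f : ℝ → ℝ) : Prop :=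
  ∃ c C : ℝ, 0 < c ∧ 0 < C ∧ ∀ N : ℕ, 1 ≤ N →
    c * f N ≤ ((E ∩ Icc N (2 * N)).ncard : ℝ) ∧ ((E ∩ Icc N (2 * N)).ncard : ℝ) ≤ C * f N

/-- Assumption 3: the Lyapunov exponent `-∑_{a∈E} μ(a) log ‖φ_a'‖` is finite. -/
def Assumption3 (E : Set ℕ) (μ : Measure ℝ) : Prop :=
  Summable fun a : E => (μ (cyl [(a : ℕ)])).toReal * Real.log (derivNorm [(a : ℕ)])

/-- `W_k = {ω : λ^{-(k+1)} < ‖φ_ω'‖ ≤ λ^{-k}}`. -/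
def W (lam : ℝ) (k : ℕ) : Set (List ℕ) :=
  {ω | lam ^ (-(k : ℝ) - 1) < derivNorm ω ∧ derivNorm ω ≤ lam ^ (-(k : ℝ))}

/-- `A_k = ⋃ {[ωa] : ω ∈ W_k ∩ E^*, a ∈ J}`. -/
def cylUnion (E : Set ℕ) (lam : ℝ) (k : ℕ) (J : Set ℕ) : Set ℝ :=
  ⋃ ω ∈ W lam k ∩ words E, ⋃ a ∈ J, cyl (ω ++ [a])

/-- `S_J`: sequences in `E^ℕ` with infinitely many `(n,k)` such that `ω|n ∈ W_k`, `ω_{n+1} ∈ J_k`. -/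
def Sset (E : Set ℕ) (lam : ℝ) (J : ℕ → Set ℕ) : Set (ℕ → ℕ) :=
  {ω | (∀ n, ω n ∈ E) ∧
    {p : ℕ × ℕ | (List.ofFn fun i : Fin p.1 => ω i) ∈ W lam p.2 ∧ ω p.1 ∈ J p.2}.Infinite}

/-- The upper density `D̄^ψ_μ(x)`. -/
def upperDensity (ψ : ℝ → ℝ) (μ : Measure ℝ) (x : ℝ) : ℝ≥0∞ :=
  limsup (fun r => μ (closedBall x r) / ENNReal.ofReal (ψ r)) (𝓝[>] (0 : ℝ))

/-- The lower density `D̲^ψ_μ(x)`. -/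
def lowerDensity (ψ : ℝ → ℝ) (μ : Measure ℝ) (x : ℝ) : ℝ≥0∞ :=
  liminf (fun r => μ (closedBall x r) / ENNReal.ofReal (ψ r)) (𝓝[>] (0 : ℝ))

/-- `J_{k,α,1} = {a ∈ E : ∃ r ∈ [‖φ_a'‖,1], r^{-δ} μ(B([a],r)) ≥ α Ψ(λ^{-k} r)}`. -/
def JsetH (E : Set ℕ) (δ : ℝ) (μ : Measure ℝ) (Ψ : ℝ → ℝ) (lam : ℝ) (k : ℕ) (α : ℝ) : Set ℕ :=
  {a ∈ E | ∃ r : ℝ, derivNorm [a] ≤ r ∧ r ≤ 1 ∧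
    ENNReal.ofReal (α * r ^ δ * Ψ (lam ^ (-(k : ℝ)) * r)) ≤ μ (cthickening r (cyl [a]))}

/-- `J_{k,α,-1} = {a ∈ E : ∃ r ∈ [‖φ_a'‖,1], r^{-δ} μ(B([a],r)) ≤ α Ψ(λ^{-k} r)}`. -/
def JsetP (E : Set ℕ) (δ : ℝ) (μ : Measure ℝ) (Ψ : ℝ → ℝ) (lam : ℝ) (k : ℕ) (α : ℝ) : Set ℕ :=
  {a ∈ E | ∃ r : ℝ, derivNorm [a] ≤ r ∧ r ≤ 1 ∧
    μ (cthickening r (cyl [a])) ≤ ENNReal.ofReal (α * r ^ δ * Ψ (lam ^ (-(k : ℝ)) * r))}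

/-- `S_{α,1}`. -/
def SsetH (E : Set ℕ) (δ : ℝ) (μ : Measure ℝ) (Ψ : ℝ → ℝ) (lam : ℝ) (α : ℝ) : Set (ℕ → ℕ) :=
  {ω | {p : ℕ × ℕ | (List.ofFn fun i : Fin p.1 => ω i) ∈ W lam p.2 ∧
    ω p.1 ∈ JsetH E δ μ Ψ lam p.2 α}.Infinite}

/-- `S_{α,-1}`. -/
def SsetP (E : Set ℕ) (δ : ℝ) (μ : Measure ℝ) (Ψ : ℝ → ℝ) (lam : ℝ) (α : ℝ) : Set (ℕ → ℕ) :=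
  {ω | {p : ℕ × ℕ | (List.ofFn fun i : Fin p.1 => ω i) ∈ W lam p.2 ∧
    ω p.1 ∈ JsetP E δ μ Ψ lam p.2 α}.Infinite}

/-- `M(x,pre,r) = ∑_{a ∈ E, [pre·a] ⊆ B(x,r)} μ([pre·a])`. -/
def Mform (E : Set ℕ) (μ : Measure ℝ) (x : ℝ) (pre : List ℕ) (r : ℝ) : ℝ≥0∞ :=
  ∑' a : {a : ℕ // a ∈ E ∧ cyl (pre ++ [a]) ⊆ closedBall x r}, μ (cyl (pre ++ [(a : ℕ)]))

/-- The pair of affine forms `(A u + B v, C u + D v)` with `φ_ω(u / v) = (A u + B v) / (C u + D v)`. -/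
def cfPair : List ℕ → ℝ → ℝ → ℝ × ℝ
  | [], u, v => (u, v)
  | a :: ω, u, v => ((cfPair ω u v).2, a * (cfPair ω u v).2 + (cfPair ω u v).1)

/-- The continuant `q(ω)`, the denominator of the convergent attached to `ω`. -/
def cfDen (ω : List ℕ) : ℝ := (cfPair ω 0 1).2

/-- The continuant of `ω` with its last letter removed. -/
def cfDenPrev (ω : List ℕ) : ℝ := (cfPair ω 1 0).2

lemma cfPair_append (ω η : List ℕ) (u v : ℝ) :
    cfPair (ω ++ η) u v = cfPair ω (cfPair η u v).1 (cfPair η u v).2 := by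
  induction ω with
  | nil => rfl
  | cons a ω ih => simp [cfPair, ih]

lemma cfPair_linear (ω : List ℕ) (u v : ℝ) :
    (cfPair ω u v).1 = u * (cfPair ω 1 0).1 + v * (cfPair ω 0 1).1 ∧
      (cfPair ω u v).2 = u * (cfPair ω 1 0).2 + v * (cfPair ω 0 1).2 := by
  induction ω with
  | nil => simp [cfPair]
  | cons a ω ih =>
    simp only [cfPair]
    refine ⟨ih.2, ?_⟩
    rw [ih.1, ih.2]
    ring

lemma cfPair_snd (ω : List ℕ) (u v : ℝ) :
    (cfPair ω u v).2 = u * cfDenPrev ω + v * cfDen ω := (cfPair_linear ω u v).2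

@[simp] lemma cfDen_nil : cfDen [] = 1 := rfl

@[simp] lemma cfDenPrev_nil : cfDenPrev [] = 0 := rfl

@[simp] lemma cfDen_singleton (a : ℕ) : cfDen [a] = a := by simp [cfDen, cfPair]

lemma cfDen_snoc (ω : List ℕ) (a : ℕ) :
    cfDen (ω ++ [a]) = a * cfDen ω + cfDenPrev ω := by
  rw [cfDen, cfPair_append, cfPair_snd]
  simp [cfPair]
  ring

lemma cfDenPrev_snoc (ω : List ℕ) (a : ℕ) : cfDenPrev (ω ++ [a]) = cfDen ω := by
  rw [cfDenPrev, cfPair_append, cfPair_snd]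
  simp [cfPair]

lemma cfPair_bounds {ω : List ℕ} (hω : ∀ a ∈ ω, 1 ≤ a) {x : ℝ} (hx : x ∈ Icc (0 : ℝ) 1) :
    0 ≤ (cfPair ω x 1).1 ∧ (cfPair ω x 1).1 ≤ (cfPair ω x 1).2 ∧ 1 ≤ (cfPair ω x 1).2 := by
  induction ω with
  | nil => simpa [cfPair] using hx
  | cons a ω ih =>
    obtain ⟨h0, h1, h2⟩ := ih fun b hb => hω b (List.mem_cons_of_mem _ hb)
    have ha : (1 : ℝ) ≤ a := by exact_mod_cast hω a List.mem_cons_self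
    simp only [cfPair]
    refine ⟨by linarith, ?_, ?_⟩ <;> nlinarith

lemma cfDenPrev_bounds {ω : List ℕ} (hω : ∀ a ∈ ω, 1 ≤ a) :
    0 ≤ cfDenPrev ω ∧ cfDenPrev ω ≤ cfDen ω ∧ 1 ≤ cfDen ω := by
  induction ω using List.reverseRecOn with
  | nil => simp
  | append_singleton ω a ih =>
    obtain ⟨h0, h1, h2⟩ := ih fun b hb => hω b (by simp [hb])
    have ha : (1 : ℝ) ≤ a := by exact_mod_cast hω a (by simp)
    rw [cfDen_snoc, cfDenPrev_snoc]
    refine ⟨by linarith, ?_, ?_⟩ <;> nlinarith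

lemma cfDen_pos {ω : List ℕ} (hω : ∀ a ∈ ω, 1 ≤ a) : 0 < cfDen ω := by
  linarith [(cfDenPrev_bounds hω).2.2]

lemma cfPair_snd_mem {ω : List ℕ} (hω : ∀ a ∈ ω, 1 ≤ a) {x : ℝ} (hx : x ∈ Icc (0 : ℝ) 1) :
    cfDen ω ≤ (cfPair ω x 1).2 ∧ (cfPair ω x 1).2 ≤ 2 * cfDen ω := by
  obtain ⟨h0, h1, h2⟩ := cfDenPrev_bounds hω
  rw [cfPair_snd]
  constructor <;> nlinarith [hx.1, hx.2]

lemma cfDen_append_bounds {ω η : List ℕ} (hω : ∀ a ∈ ω, 1 ≤ a) (hη : ∀ a ∈ η, 1 ≤ a) :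
    cfDen ω * cfDen η ≤ cfDen (ω ++ η) ∧ cfDen (ω ++ η) ≤ 2 * (cfDen ω * cfDen η) := by
  obtain ⟨h0, h1, h2⟩ := cfDenPrev_bounds hω
  obtain ⟨k0, k1, k2⟩ := cfPair_bounds hη (x := 0) (by simp)
  have e : cfDen (ω ++ η) = (cfPair η 0 1).1 * cfDenPrev ω + (cfPair η 0 1).2 * cfDen ω := by
    rw [cfDen, cfPair_append, cfPair_snd]
  rw [e, show cfDen η = (cfPair η 0 1).2 from rfl]
  constructor <;> nlinarith

lemma length_le_cfDen {ω : List ℕ} (hω : ∀ a ∈ ω, 1 ≤ a) : (ω.length : ℝ) ≤ cfDen ω := by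
  induction ω using List.reverseRecOn with
  | nil => simp
  | append_singleton ω a ih =>
    have hω' : ∀ b ∈ ω, 1 ≤ b := fun b hb => hω b (by simp [hb])
    obtain ⟨h0, h1, h2⟩ := cfDenPrev_bounds hω'
    have ha : (1 : ℝ) ≤ a := by exact_mod_cast hω a (by simp)
    rw [cfDen_snoc]
    rcases ω.eq_nil_or_concat with rfl | ⟨η, b, rfl⟩
    · simpa using ha
    · have hη : ∀ c ∈ η, 1 ≤ c := fun c hc => hω' c (by simp [hc])
      have := ih hω'
      rw [List.concat_eq_append] at *
      rw [List.length_append, cfDenPrev_snoc]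
      have h3 := (cfDenPrev_bounds hη).2.2
      push_cast
      simp only [List.length_singleton, Nat.cast_one]
      nlinarith

lemma gaussMap_mem {a : ℕ} (ha : 1 ≤ a) {x : ℝ} (hx : x ∈ Icc (0 : ℝ) 1) :
    gaussMap a x ∈ Icc (0 : ℝ) 1 := by
  have ha : (1 : ℝ) ≤ a := by exact_mod_cast ha
  have := hx.1
  unfold gaussMap
  exact ⟨by positivity, by rw [div_le_one] <;> linarith⟩

lemma wordMap_mem {ω : List ℕ} (hω : ∀ a ∈ ω, 1 ≤ a) {x : ℝ} (hx : x ∈ Icc (0 : ℝ) 1) :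
    wordMap ω x ∈ Icc (0 : ℝ) 1 := by
  induction ω with
  | nil => exact hx
  | cons a ω ih =>
    exact gaussMap_mem (hω a List.mem_cons_self) (ih fun b hb => hω b (List.mem_cons_of_mem _ hb))

lemma wordMap_append (ω η : List ℕ) (x : ℝ) : wordMap (ω ++ η) x = wordMap ω (wordMap η x) := by
  induction ω with
  | nil => rfl
  | cons a ω ih => simp [wordMap, ih]

lemma wordMap_eq_div {ω : List ℕ} (hω : ∀ a ∈ ω, 1 ≤ a) {x : ℝ} (hx : x ∈ Icc (0 : ℝ) 1) :
    wordMap ω x = (cfPair ω x 1).1 / (cfPair ω x 1).2 := by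
  induction ω with
  | nil => simp [wordMap, cfPair]
  | cons a ω ih =>
    have hω' : ∀ b ∈ ω, 1 ≤ b := fun b hb => hω b (List.mem_cons_of_mem _ hb)
    obtain ⟨h0, h1, h2⟩ := cfPair_bounds hω' hx
    obtain ⟨k0, k1, k2⟩ := cfPair_bounds hω hx
    simp only [cfPair] at k2
    simp only [wordMap, gaussMap, ih hω', cfPair]
    field_simp

lemma add_wordMap_mul {a : ℕ} {ω : List ℕ} (hω : ∀ a ∈ ω, 1 ≤ a) {x : ℝ}
    (hx : x ∈ Icc (0 : ℝ) 1) :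
    (a + wordMap ω x) * (cfPair ω x 1).2 = (cfPair (a :: ω) x 1).2 := by
  obtain ⟨h0, h1, h2⟩ := cfPair_bounds hω hx
  rw [wordMap_eq_div hω hx]
  simp only [cfPair]
  field_simp

lemma gaussMap_hasDerivAt {a : ℕ} {x : ℝ} (h : (a : ℝ) + x ≠ 0) :
    HasDerivAt (gaussMap a) (-(((a : ℝ) + x) ^ 2)⁻¹) x := by
  unfold gaussMap
  simpa [div_eq_mul_inv] using ((hasDerivAt_id x).const_add (a : ℝ)).fun_inv h

lemma wordMap_hasDerivAt {ω : List ℕ} (hω : ∀ a ∈ ω, 1 ≤ a) {x : ℝ} (hx : x ∈ Icc (0 : ℝ) 1) :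
    ∃ d : ℝ, HasDerivAt (wordMap ω) d x ∧ |d| = ((cfPair ω x 1).2 ^ 2)⁻¹ := by
  induction ω with
  | nil => exact ⟨1, hasDerivAt_id x, by simp [cfPair]⟩
  | cons a ω ih =>
    have hω' : ∀ b ∈ ω, 1 ≤ b := fun b hb => hω b (List.mem_cons_of_mem _ hb)
    obtain ⟨d, hd, e⟩ := ih hω'
    have ha : (1 : ℝ) ≤ a := by exact_mod_cast hω a List.mem_cons_self
    have h := (wordMap_mem hω' hx).1
    refine ⟨_, (gaussMap_hasDerivAt (a := a) (x := wordMap ω x) (by positivity)).comp x hd, ?_⟩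
    rw [abs_mul, e, abs_neg, abs_of_nonneg (by positivity), ← add_wordMap_mul hω' hx, mul_pow,
      mul_inv]

lemma derivNorm_eq {ω : List ℕ} (hω : ∀ a ∈ ω, 1 ≤ a) : derivNorm ω = (cfDen ω ^ 2)⁻¹ := by
  have key : ∀ x : Icc (0 : ℝ) 1,
      |deriv (wordMap ω) (x : ℝ)| = ((cfPair ω x 1).2 ^ 2)⁻¹ := by
    intro x
    obtain ⟨d, hd, e⟩ := wordMap_hasDerivAt hω x.2
    rw [hd.deriv, e]
  have hq := cfDen_pos hω
  have hle : ∀ x : Icc (0 : ℝ) 1, |deriv (wordMap ω) (x : ℝ)| ≤ (cfDen ω ^ 2)⁻¹ := by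
    intro x
    rw [key]
    have := (cfPair_snd_mem hω x.2).1
    gcongr
  unfold derivNorm
  apply le_antisymm
  · exact ciSup_le hle
  · refine le_trans (le_of_eq ?_) (le_ciSup (f := fun x : Icc (0 : ℝ) 1 =>
      |deriv (wordMap ω) (x : ℝ)|) ⟨_, forall_mem_range.2 hle⟩ ⟨0, by simp⟩)
    rw [key]
    rfl

lemma abs_wordMap_sub {ω : List ℕ} (hω : ∀ a ∈ ω, 1 ≤ a) {x y : ℝ} (hx : x ∈ Icc (0 : ℝ) 1)
    (hy : y ∈ Icc (0 : ℝ) 1) :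
    |wordMap ω x - wordMap ω y| * ((cfPair ω x 1).2 * (cfPair ω y 1).2) = |x - y| := by
  induction ω with
  | nil => simp [wordMap, cfPair]
  | cons a ω ih =>
    have hω' : ∀ b ∈ ω, 1 ≤ b := fun b hb => hω b (List.mem_cons_of_mem _ hb)
    have ha : (1 : ℝ) ≤ a := by exact_mod_cast hω a List.mem_cons_self
    have h1 := (wordMap_mem hω' hx).1
    have h2 := (wordMap_mem hω' hy).1
    have p1 : 0 < (a : ℝ) + wordMap ω x := by positivity
    have p2 : 0 < (a : ℝ) + wordMap ω y := by positivity
    rw [← ih hω', ← add_wordMap_mul hω' hx, ← add_wordMap_mul hω' hy]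
    have e : wordMap (a :: ω) x - wordMap (a :: ω) y =
        -(wordMap ω x - wordMap ω y) / ((a + wordMap ω x) * (a + wordMap ω y)) := by
      simp only [wordMap, gaussMap]
      field_simp
      ring
    rw [e, abs_div, abs_neg, abs_of_pos (mul_pos p1 p2)]
    field_simp

lemma abs_wordMap_sub_le {ω : List ℕ} (hω : ∀ a ∈ ω, 1 ≤ a) {x y : ℝ} (hx : x ∈ Icc (0 : ℝ) 1)
    (hy : y ∈ Icc (0 : ℝ) 1) : |wordMap ω x - wordMap ω y| * ω.length ≤ 1 := by
  have h := abs_wordMap_sub hω hx hy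
  have h1 : |x - y| ≤ 1 := by
    rw [abs_le]
    constructor <;> linarith [hx.1, hx.2, hy.1, hy.2]
  have h2 := (cfPair_snd_mem hω hx).1
  have h3 := (cfPair_bounds hω hy).2.2
  have h4 := length_le_cfDen hω
  have h5 : (0 : ℝ) ≤ ω.length := by positivity
  calc |wordMap ω x - wordMap ω y| * ω.length
      ≤ |wordMap ω x - wordMap ω y| * ((cfPair ω x 1).2 * (cfPair ω y 1).2) := by
        gcongr
        nlinarith
    _ ≤ 1 := h ▸ h1

lemma cyl_subset_Icc {ω : List ℕ} (hω : ∀ a ∈ ω, 1 ≤ a) : cyl ω ⊆ Icc 0 1 := by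
  rintro _ ⟨x, hx, rfl⟩
  exact wordMap_mem hω hx

lemma measurableSet_cyl {ω : List ℕ} (hω : ∀ a ∈ ω, 1 ≤ a) : MeasurableSet (cyl ω) := by
  refine (isCompact_Icc.image_of_continuousOn fun x hx => ?_).isClosed.measurableSet
  obtain ⟨d, hd, -⟩ := wordMap_hasDerivAt hω hx
  exact hd.continuousAt.continuousWithinAt

lemma cyl_append_subset {ω η : List ℕ} (hη : ∀ a ∈ η, 1 ≤ a) : cyl (ω ++ η) ⊆ cyl ω := by
  rintro _ ⟨x, hx, rfl⟩
  exact ⟨wordMap η x, wordMap_mem hη hx, (wordMap_append ω η x).symm⟩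

lemma irrational_of_gaussMap {a : ℕ} {x : ℝ} (h : Irrational (gaussMap a x)) : Irrational x := by
  rintro ⟨r, rfl⟩
  exact h ⟨1 / (a + r), by simp [gaussMap]⟩

lemma Ioo_of_irrational {x : ℝ} (hx : x ∈ Icc (0 : ℝ) 1) (h : Irrational x) :
    x ∈ Ioo (0 : ℝ) 1 :=
  ⟨hx.1.lt_of_ne h.ne_zero.symm, hx.2.lt_of_ne h.ne_one⟩

lemma gaussMap_inj {a b : ℕ} (ha : 1 ≤ a) (hb : 1 ≤ b) {s t : ℝ} (hs : s ∈ Ioo (0 : ℝ) 1)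
    (ht : t ∈ Ioo (0 : ℝ) 1) (h : gaussMap a s = gaussMap b t) : a = b ∧ s = t := by
  have ha' : (1 : ℝ) ≤ a := by exact_mod_cast ha
  have hb' : (1 : ℝ) ≤ b := by exact_mod_cast hb
  have e : (a : ℝ) + s = b + t := by
    simpa [gaussMap] using h
  have e1 : (a : ℝ) < b + 1 := by linarith [hs.1, ht.2]
  have e2 : (b : ℝ) < a + 1 := by linarith [hs.2, ht.1]
  have e1' : a < b + 1 := by exact_mod_cast e1
  have e2' : b < a + 1 := by exact_mod_cast e2
  obtain rfl : a = b := by omega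
  exact ⟨rfl, by linarith⟩

lemma comparable_of_mem_cyl {ω τ : List ℕ} (hω : ∀ a ∈ ω, 1 ≤ a) (hτ : ∀ a ∈ τ, 1 ≤ a) {x : ℝ}
    (hx : Irrational x) (h1 : x ∈ cyl ω) (h2 : x ∈ cyl τ) : ω <+: τ ∨ τ <+: ω := by
  induction ω generalizing τ x with
  | nil => exact Or.inl τ.nil_prefix
  | cons a ω ih =>
    cases τ with
    | nil => exact Or.inr (List.nil_prefix)
    | cons b τ =>
      have hω' : ∀ b ∈ ω, 1 ≤ b := fun b hb => hω b (List.mem_cons_of_mem _ hb)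
      have hτ' : ∀ b ∈ τ, 1 ≤ b := fun b hb => hτ b (List.mem_cons_of_mem _ hb)
      obtain ⟨s, hs, rfl⟩ := h1
      obtain ⟨t, ht, e⟩ := h2
      simp only [wordMap] at hx e
      have is := irrational_of_gaussMap hx
      have it := irrational_of_gaussMap (e ▸ hx)
      obtain ⟨rfl, e'⟩ := gaussMap_inj (hω a List.mem_cons_self) (hτ b List.mem_cons_self)
        (Ioo_of_irrational (wordMap_mem hω' hs) is) (Ioo_of_irrational (wordMap_mem hτ' ht) it)
        e.symm
      have := ih hω' hτ' is ⟨s, hs, rfl⟩ ⟨t, ht, e'.symm⟩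
      simpa [List.cons_prefix_cons] using this

lemma one_le_of_mem_words {E : Set ℕ} (hE : 0 ∉ E) {ω : List ℕ} (hω : ω ∈ words E) :
    ∀ a ∈ ω, 1 ≤ a := fun a ha =>
  Nat.one_le_iff_ne_zero.2 fun h => hE (h ▸ hω a ha)

lemma codingMap_mem_Icc {ω : ℕ → ℕ} (hω : ∀ n, 1 ≤ ω n) : codingMap ω ∈ Icc (0 : ℝ) 1 := by
  have hpos : ∀ n, ∀ a ∈ List.ofFn fun i : Fin n => ω i, 1 ≤ a := by
    intro n a ha
    obtain ⟨i, rfl⟩ := (List.mem_ofFn' _ _).1 ha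
    exact hω i
  have h0 : (0 : ℝ) ∈ Icc (0 : ℝ) 1 := by simp
  have hmem : ∀ n, wordMap (List.ofFn fun i : Fin n => ω i) 0 ∈ Icc (0 : ℝ) 1 :=
    fun n => wordMap_mem (hpos n) h0
  have hc : CauchySeq fun n => wordMap (List.ofFn fun i : Fin n => ω i) 0 := by
    refine Metric.cauchySeq_iff'.2 fun ε hε => ?_
    obtain ⟨N, hN⟩ := exists_nat_gt (1 / ε)
    refine ⟨N, fun n hn => ?_⟩
    obtain ⟨k, rfl⟩ := Nat.exists_eq_add_of_le hn
    have e : (List.ofFn fun i : Fin (N + k) => ω i) =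
        (List.ofFn fun i : Fin N => ω i) ++ List.ofFn fun i : Fin k => ω (N + i) := by
      rw [List.ofFn_add]
      simp
    have hk : ∀ a ∈ List.ofFn fun i : Fin k => ω (N + i), 1 ≤ a := by
      intro a ha
      obtain ⟨i, rfl⟩ := (List.mem_ofFn' _ _).1 ha
      exact hω _
    have := abs_wordMap_sub_le (hpos N) (wordMap_mem hk h0) h0
    rw [List.length_ofFn] at this
    rw [e, wordMap_append, Real.dist_eq]
    have hN' : 0 < (N : ℝ) := lt_trans (by positivity) hN
    rw [div_lt_iff₀ hε] at hN
    nlinarith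
  obtain ⟨l, hl⟩ := cauchySeq_tendsto_of_complete hc
  rw [codingMap, hl.limUnder_eq]
  exact isClosed_Icc.mem_of_tendsto hl (Eventually.of_forall hmem)

lemma IsConformal.ae_mem_Icc {E : Set ℕ} {δ : ℝ} {μ : Measure ℝ} (hE : 0 ∉ E)
    (hμ : IsConformal E δ μ) : ∀ᵐ x ∂μ, x ∈ Icc (0 : ℝ) 1 := by
  refine measure_mono_null (compl_subset_compl.2 ?_) hμ.2.1
  rintro _ ⟨ω, hω, rfl⟩
  exact codingMap_mem_Icc fun n => Nat.one_le_iff_ne_zero.2 fun h => hE (h ▸ hω n)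

/-- The weight `|φ_ω'|^δ`, as a function on `[0,1]`. -/
def cfWeight (δ : ℝ) (ω : List ℕ) (x : ℝ) : ℝ≥0∞ :=
  ENNReal.ofReal ((cfPair ω x 1).2 ^ (-(2 * δ)))

lemma measurable_cfPair (ω : List ℕ) : Measurable fun x => (cfPair ω x 1).2 := by
  simp only [cfPair_snd]
  fun_prop

lemma measurable_cfWeight (δ : ℝ) (ω : List ℕ) : Measurable (cfWeight δ ω) :=
  ((measurable_cfPair ω).pow_const _).ennreal_ofReal

lemma measurable_gaussMap (a : ℕ) : Measurable (gaussMap a) := by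
  unfold gaussMap
  fun_prop

lemma abs_deriv_gaussMap_rpow {δ : ℝ} {a : ℕ} (ha : 1 ≤ a) {x : ℝ} (hx : x ∈ Icc (0 : ℝ) 1) :
    |deriv (gaussMap a) x| ^ δ = (cfPair [a] x 1).2 ^ (-(2 * δ)) := by
  have ha : (1 : ℝ) ≤ a := by exact_mod_cast ha
  have := hx.1
  have h : 0 < (a : ℝ) + x := by positivity
  rw [(gaussMap_hasDerivAt h.ne').deriv, abs_neg, abs_of_nonneg (by positivity),
    Real.inv_rpow (by positivity), Real.rpow_neg (by simp [cfPair, h.le]),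
    Real.rpow_mul (by simp [cfPair, h.le])]
  simp [cfPair]

lemma IsConformal.measure_eq {E : Set ℕ} {δ : ℝ} {μ : Measure ℝ} (hE : 0 ∉ E) (hδ : 0 ≤ δ)
    (hμ : IsConformal E δ μ) {A : Set ℝ} (hA : A ⊆ Icc 0 1) (hA' : MeasurableSet A) :
    μ A = ∑' a : E, ∫⁻ x in gaussMap (a : ℕ) ⁻¹' A, cfWeight δ [(a : ℕ)] x ∂μ := by
  have := hμ.1
  rw [hμ.2.2 A hA hA']
  congr 1
  ext ⟨a, ha⟩
  have ha1 : 1 ≤ a := Nat.one_le_iff_ne_zero.2 fun h => hE (h ▸ ha)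
  have hae : ∀ᵐ x ∂(μ.restrict (gaussMap a ⁻¹' A)), x ∈ Icc (0 : ℝ) 1 :=
    ae_restrict_of_ae (hμ.ae_mem_Icc hE)
  have hm : Measurable fun x => |deriv (gaussMap a) x| ^ δ :=
    (measurable_deriv (gaussMap a)).norm.pow_const δ
  rw [ofReal_integral_eq_lintegral_ofReal]
  · refine lintegral_congr_ae ?_
    filter_upwards [hae] with x hx
    rw [abs_deriv_gaussMap_rpow ha1 hx, cfWeight]
  · refine Integrable.of_bound hm.aestronglyMeasurable 1 ?_
    filter_upwards [hae] with x hx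
    rw [Real.norm_of_nonneg (by positivity), abs_deriv_gaussMap_rpow ha1 hx]
    exact Real.rpow_le_one_of_one_le_of_nonpos
      (cfPair_bounds (ω := [a]) (by simpa using ha1) hx).2.2 (by linarith)
  · exact Eventually.of_forall fun x => by positivity

lemma IsConformal.measure_eq_zero {E : Set ℕ} {δ : ℝ} {μ : Measure ℝ} (hE : 0 ∉ E)
    (hδ : 0 ≤ δ) (hμ : IsConformal E δ μ) {A : Set ℝ} (hA : A ⊆ Icc 0 1)
    (hA' : MeasurableSet A) (h : ∀ a ∈ E, μ (gaussMap a ⁻¹' A) = 0) : μ A = 0 := by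
  rw [hμ.measure_eq hE hδ hA hA', ENNReal.tsum_eq_zero]
  rintro ⟨a, ha⟩
  exact setLIntegral_measure_zero _ _ (h a ha)

lemma IsConformal.measure_ratio {E : Set ℕ} {δ : ℝ} {μ : Measure ℝ} (hE : 0 ∉ E)
    (hδ : 0 ≤ δ) (hμ : IsConformal E δ μ) (n : ℕ) (m : ℤ) : μ {(m / n : ℝ)} = 0 := by
  have hout : ∀ x : ℝ, x ∉ Icc (0 : ℝ) 1 → μ {x} = 0 := fun x hx =>
    measure_mono_null (by simpa using hx) (hμ.ae_mem_Icc hE)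
  have hpos : ∀ a ∈ E, (1 : ℝ) ≤ a := fun a ha => by
    exact_mod_cast Nat.one_le_iff_ne_zero.2 fun h => hE (h ▸ ha)
  have hpre : ∀ (a : ℕ) (x : ℝ), gaussMap a ⁻¹' {x} ⊆ {1 / x - a} := by
    rintro a x y rfl
    simp [gaussMap]
  have h0 : μ {(0 : ℝ)} = 0 := by
    refine hμ.measure_eq_zero hE hδ (by simp) (measurableSet_singleton _) fun a ha => ?_
    refine measure_mono_null (hpre a 0) (hout _ fun h => ?_)
    have := h.1
    simp only [div_zero] at this
    linarith [hpos a ha]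
  have h1 : μ {(1 : ℝ)} = 0 := by
    refine hμ.measure_eq_zero hE hδ (by simp) (measurableSet_singleton _) fun a ha => ?_
    refine measure_mono_null (hpre a 1) ?_
    rcases (hpos a ha).eq_or_lt with h | h
    · simpa [← h] using h0
    · exact hout _ fun h' => by linarith [h'.1]
  induction n using Nat.strong_induction_on generalizing m with
  | _ n ih =>
    by_cases hx : (m / n : ℝ) ∈ Icc (0 : ℝ) 1
    swap
    · exact hout _ hx
    rcases Nat.eq_zero_or_pos n with rfl | hn
    · simpa using h0
    have hn' : (0 : ℝ) < n := by exact_mod_cast hn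
    have hm0 : (0 : ℤ) ≤ m := by
      have := hx.1
      rw [le_div_iff₀ hn', zero_mul] at this
      exact_mod_cast this
    have hm1 : m ≤ n := by
      have := hx.2
      rw [div_le_one hn'] at this
      exact_mod_cast this
    lift m to ℕ using hm0
    rcases (Int.ofNat_le.1 hm1).eq_or_lt with rfl | hmn
    · simpa [hn.ne'] using h1
    rcases Nat.eq_zero_or_pos m with rfl | hm
    · simpa using h0
    refine hμ.measure_eq_zero hE hδ (by simpa using hx) (measurableSet_singleton _)
      fun a ha => ?_
    refine measure_mono_null (hpre a _) ?_
    have := ih m hmn (n - a * m)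
    convert this using 2
    have hm' : (0 : ℝ) < m := by exact_mod_cast hm
    push_cast
    field_simp

lemma IsConformal.ae_irrational {E : Set ℕ} {δ : ℝ} {μ : Measure ℝ} (hE : 0 ∉ E)
    (hδ : 0 ≤ δ) (hμ : IsConformal E δ μ) : ∀ᵐ x ∂μ, Irrational x := by
  have h : μ (⋃ r : ℚ, {(r : ℝ)}) = 0 := by
    refine measure_iUnion_null fun r => ?_
    rw [Rat.cast_def]
    exact hμ.measure_ratio hE hδ r.den r.num
  refine measure_mono_null ?_ h
  intro x hx
  simp only [Irrational, mem_compl_iff, mem_ofPred_eq, not_not] at hx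
  obtain ⟨r, rfl⟩ := hx
  simp

lemma IsConformal.lintegral_cyl_singleton {E : Set ℕ} {δ : ℝ} {μ : Measure ℝ} (hE : 0 ∉ E)
    (hδ : 0 ≤ δ) (hμ : IsConformal E δ μ) {a : ℕ} (ha : a ∈ E) {f : ℝ → ℝ≥0∞}
    (hf : Measurable f) :
    ∫⁻ x in cyl [a], f x ∂μ = ∫⁻ x, f (gaussMap a x) * cfWeight δ [a] x ∂μ := by
  have hpos : ∀ b ∈ E, 1 ≤ b := fun b hb => Nat.one_le_iff_ne_zero.2 fun h => hE (h ▸ hb)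
  have ha1 : ∀ b ∈ [a], 1 ≤ b := by simpa using hpos a ha
  have key : μ.restrict (cyl [a]) = (μ.withDensity (cfWeight δ [a])).map (gaussMap a) := by
    ext S hS
    rw [Measure.restrict_apply hS, Measure.map_apply (measurable_gaussMap a) hS,
      withDensity_apply _ (measurable_gaussMap a hS),
      hμ.measure_eq hE hδ (inter_subset_right.trans (cyl_subset_Icc ha1))
        (hS.inter (measurableSet_cyl ha1)), tsum_eq_single ⟨a, ha⟩]
    · refine setLIntegral_congr ?_
      filter_upwards [hμ.ae_mem_Icc hE] with x hx
      refine propext ⟨fun h => h.1, fun h => ⟨h, x, hx, rfl⟩⟩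
    · rintro ⟨b, hb⟩ hne
      refine setLIntegral_measure_zero _ _ (measure_mono_null
        (t := {x | x ∈ Icc (0 : ℝ) 1 ∧ Irrational x}ᶜ) ?_
        ((hμ.ae_mem_Icc hE).and (hμ.ae_irrational hE hδ)))
      rintro x ⟨-, t, ht, e⟩ ⟨hx, hxi⟩
      simp only [wordMap] at e
      have hti : Irrational t := by
        refine irrational_of_gaussMap (a := a) (e ▸ ?_)
        rintro ⟨r, hr⟩
        refine hxi ⟨1 / r - b, ?_⟩
        push_cast
        rw [hr]
        simp [gaussMap]
      exact hne (Subtype.ext (gaussMap_inj (hpos a ha) (hpos b hb) (Ioo_of_irrational ht hti)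
        (Ioo_of_irrational hx hxi) e).1.symm)
  rw [key, lintegral_map hf (measurable_gaussMap a)]
  refine (lintegral_withDensity_eq_lintegral_mul μ (measurable_cfWeight δ [a])
    (hf.comp (measurable_gaussMap a))).trans ?_
  simp [mul_comm]

lemma IsConformal.lintegral_cyl {E : Set ℕ} {δ : ℝ} {μ : Measure ℝ} (hE : 0 ∉ E)
    (hδ : 0 ≤ δ) (hμ : IsConformal E δ μ) {ω : List ℕ} (hω : ω ∈ words E) {f : ℝ → ℝ≥0∞}
    (hf : Measurable f) :
    ∫⁻ x in cyl ω, f x ∂μ = ∫⁻ x, f (wordMap ω x) * cfWeight δ ω x ∂μ := by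
  induction ω generalizing f with
  | nil =>
    have : ∀ᵐ x ∂μ, x ∈ cyl [] := by simpa [cyl, wordMap] using hμ.ae_mem_Icc hE
    rw [Measure.restrict_eq_self_of_ae_mem this]
    simp [wordMap, cfWeight, cfPair]
  | cons a ω ih =>
    have hω' : ω ∈ words E := fun b hb => hω b (List.mem_cons_of_mem _ hb)
    have ha : a ∈ E := hω a List.mem_cons_self
    have p := one_le_of_mem_words hE hω
    have p' := one_le_of_mem_words hE hω'
    have hsub : cyl (a :: ω) ⊆ cyl [a] := cyl_append_subset (ω := [a]) p'
    have hm := measurableSet_cyl p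
    calc ∫⁻ x in cyl (a :: ω), f x ∂μ
        = ∫⁻ x in cyl [a], (cyl (a :: ω)).indicator f x ∂μ := by
          rw [lintegral_indicator hm, Measure.restrict_restrict hm, inter_eq_left.2 hsub]
      _ = ∫⁻ x, (cyl (a :: ω)).indicator f (gaussMap a x) * cfWeight δ [a] x ∂μ :=
          hμ.lintegral_cyl_singleton hE hδ ha (hf.indicator hm)
      _ = ∫⁻ x, (cyl ω).indicator (fun y => f (gaussMap a y) * cfWeight δ [a] y) x ∂μ := by
          refine lintegral_congr_ae ?_
          filter_upwards [hμ.ae_mem_Icc hE] with x hx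
          have hiff : gaussMap a x ∈ cyl (a :: ω) ↔ x ∈ cyl ω := by
            constructor
            · rintro ⟨t, ht, e⟩
              refine ⟨t, ht, ?_⟩
              simpa [wordMap, gaussMap] using e
            · rintro ⟨t, ht, rfl⟩
              exact ⟨t, ht, rfl⟩
          by_cases h : x ∈ cyl ω
          · rw [indicator_of_mem h, indicator_of_mem (hiff.2 h)]
          · rw [indicator_of_notMem h, indicator_of_notMem (hiff.not.2 h), zero_mul]
      _ = ∫⁻ x in cyl ω, f (gaussMap a x) * cfWeight δ [a] x ∂μ :=
          lintegral_indicator (measurableSet_cyl p') _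
      _ = ∫⁻ x, f (gaussMap a (wordMap ω x)) * cfWeight δ [a] (wordMap ω x) *
            cfWeight δ ω x ∂μ :=
          ih hω' (f := fun x => f (gaussMap a x) * cfWeight δ [a] x)
            ((hf.comp (measurable_gaussMap a)).mul (measurable_cfWeight δ [a]))
      _ = ∫⁻ x, f (wordMap (a :: ω) x) * cfWeight δ (a :: ω) x ∂μ := by
          refine lintegral_congr_ae ?_
          filter_upwards [hμ.ae_mem_Icc hE] with x hx
          have h1 := (wordMap_mem p' hx).1
          have h2 := (cfPair_bounds p' hx).2.2
          rw [mul_assoc, cfWeight, cfWeight, cfWeight,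
            ← ENNReal.ofReal_mul (Real.rpow_nonneg (by simp [cfPair]; positivity) _),
            ← Real.mul_rpow (by simp [cfPair]; positivity) (by linarith),
            ← add_wordMap_mul p' hx]
          simp [cfPair, wordMap]

lemma IsConformal.measure_cyl_bounds {E : Set ℕ} {δ : ℝ} {μ : Measure ℝ} (hE : 0 ∉ E)
    (hδ : 0 ≤ δ) (hμ : IsConformal E δ μ) {ω : List ℕ} (hω : ω ∈ words E) :
    ENNReal.ofReal ((2 * cfDen ω) ^ (-(2 * δ))) ≤ μ (cyl ω) ∧
      μ (cyl ω) ≤ ENNReal.ofReal (cfDen ω ^ (-(2 * δ))) := by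
  have := hμ.1
  have p := one_le_of_mem_words hE hω
  have e : μ (cyl ω) = ∫⁻ x, cfWeight δ ω x ∂μ := by
    simpa using hμ.lintegral_cyl hE hδ hω (f := fun _ => 1) measurable_const
  have hq := cfDen_pos p
  rw [e]
  constructor
  · calc _ = ∫⁻ _, ENNReal.ofReal ((2 * cfDen ω) ^ (-(2 * δ))) ∂μ := by simp
      _ ≤ _ := by
        refine lintegral_mono_ae ?_
        filter_upwards [hμ.ae_mem_Icc hE] with x hx
        have h := cfPair_snd_mem p hx
        exact ENNReal.ofReal_le_ofReal
          (Real.rpow_le_rpow_of_nonpos (by linarith) h.2 (by linarith))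
  · calc _ ≤ ∫⁻ _, ENNReal.ofReal (cfDen ω ^ (-(2 * δ))) ∂μ := by
          refine lintegral_mono_ae ?_
          filter_upwards [hμ.ae_mem_Icc hE] with x hx
          have h := cfPair_snd_mem p hx
          exact ENNReal.ofReal_le_ofReal
            (Real.rpow_le_rpow_of_nonpos (by linarith) h.1 (by linarith))
      _ = _ := by simp

lemma IsConformal.ae_exists_word {E : Set ℕ} {δ : ℝ} {μ : Measure ℝ} (hE : 0 ∉ E)
    (hδ : 0 ≤ δ) (hμ : IsConformal E δ μ) (n : ℕ) :
    ∀ᵐ x ∂μ, ∃ ω ∈ words E, ω.length = n ∧ x ∈ cyl ω := by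
  have hmeas : ∀ n, MeasurableSet (⋃ ω ∈ {ω | ω ∈ words E ∧ ω.length = n}, cyl ω) := fun n =>
    MeasurableSet.biUnion (to_countable _) fun ω hω =>
      measurableSet_cyl (one_le_of_mem_words hE hω.1)
  suffices h : μ (Icc 0 1 \ ⋃ ω ∈ {ω | ω ∈ words E ∧ ω.length = n}, cyl ω) = 0 by
    have h' : ∀ᵐ x ∂μ, x ∉ Icc 0 1 \ ⋃ ω ∈ {ω | ω ∈ words E ∧ ω.length = n}, cyl ω :=
      measure_eq_zero_iff_ae_notMem.1 h
    filter_upwards [hμ.ae_mem_Icc hE, h'] with x hx hx'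
    simp only [Set.mem_sdiff, hx, true_and, not_not, mem_iUnion] at hx'
    obtain ⟨ω, ⟨h1, h2⟩, h3⟩ := hx'
    exact ⟨ω, h1, h2, h3⟩
  induction n with
  | zero =>
    convert measure_empty (μ := μ)
    refine sdiff_eq_empty.2 fun x hx => mem_biUnion (x := []) ⟨?_, rfl⟩ ⟨x, hx, rfl⟩
    simp [words]
  | succ n ih =>
    refine hμ.measure_eq_zero hE hδ sdiff_subset (measurableSet_Icc.diff (hmeas _))
      fun a ha => ?_
    have h' : ∀ᵐ x ∂μ, x ∉ Icc 0 1 \ ⋃ ω ∈ {ω | ω ∈ words E ∧ ω.length = n}, cyl ω :=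
      measure_eq_zero_iff_ae_notMem.1 ih
    refine measure_eq_zero_iff_ae_notMem.2 ?_
    filter_upwards [hμ.ae_mem_Icc hE, h'] with x hx hx' hcon
    simp only [Set.mem_sdiff, hx, true_and, not_not, mem_iUnion] at hx'
    obtain ⟨ω, ⟨h1, h2⟩, t, ht, rfl⟩ := hx'
    refine hcon.2 (mem_biUnion (x := a :: ω) ⟨?_, by simp [h2]⟩ ⟨t, ht, rfl⟩)
    intro b hb
    rcases List.mem_cons.1 hb with rfl | hb
    · exact ha
    · exact h1 b hb

lemma IsConformal.measure_cyl_nil {E : Set ℕ} {δ : ℝ} {μ : Measure ℝ} (hE : 0 ∉ E)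
    (hμ : IsConformal E δ μ) : μ (cyl []) = 1 := by
  have := hμ.1
  have h : ∀ᵐ x ∂μ, x ∈ cyl [] := by simpa [cyl, wordMap] using hμ.ae_mem_Icc hE
  exact (prob_compl_eq_zero_iff (measurableSet_cyl (by simp))).1 h

lemma IsConformal.measure_cyl_ne_zero {E : Set ℕ} {δ : ℝ} {μ : Measure ℝ} (hE : 0 ∉ E)
    (hδ : 0 ≤ δ) (hμ : IsConformal E δ μ) {ω : List ℕ} (hω : ω ∈ words E) : μ (cyl ω) ≠ 0 := by
  have := cfDen_pos (one_le_of_mem_words hE hω)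
  refine (lt_of_lt_of_le ?_ (hμ.measure_cyl_bounds hE hδ hω).1).ne'
  exact ENNReal.ofReal_pos.2 (by positivity)

lemma IsConformal.measure_cyl_le_of_cfDen_le {E : Set ℕ} {δ : ℝ} {μ : Measure ℝ} (hE : 0 ∉ E)
    (hδ : 0 ≤ δ) (hμ : IsConformal E δ μ) {σ τ : List ℕ} (hσ : σ ∈ words E) (hτ : τ ∈ words E)
    {R : ℝ} (hR : 0 < R) (h : cfDen σ ≤ R * cfDen τ) :
    μ (cyl τ) ≤ ENNReal.ofReal ((2 * R) ^ (2 * δ)) * μ (cyl σ) := by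
  have pσ := cfDen_pos (one_le_of_mem_words hE hσ)
  have pτ := cfDen_pos (one_le_of_mem_words hE hτ)
  refine (hμ.measure_cyl_bounds hE hδ hτ).2.trans
    (le_trans ?_ (mul_le_mul_right (hμ.measure_cyl_bounds hE hδ hσ).1 _))
  rw [← ENNReal.ofReal_mul (by positivity)]
  refine ENNReal.ofReal_le_ofReal ?_
  have e : cfDen τ ^ (-(2 * δ)) = (2 * R) ^ (2 * δ) * (2 * R * cfDen τ) ^ (-(2 * δ)) := by
    rw [Real.mul_rpow (by positivity) pτ.le, ← mul_assoc, ← Real.rpow_add (by positivity)]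
    simp
  rw [e]
  gcongr 1
  exact Real.rpow_le_rpow_of_nonpos (by positivity) (by linarith) (by linarith)

lemma words_append {E : Set ℕ} {ω η : List ℕ} :
    ω ++ η ∈ words E ↔ ω ∈ words E ∧ η ∈ words E := by
  simp only [words, mem_ofPred_eq, List.mem_append]
  exact ⟨fun h => ⟨fun a ha => h a (Or.inl ha), fun a ha => h a (Or.inr ha)⟩,
    fun h a ha => ha.elim (h.1 a) (h.2 a)⟩

lemma words_singleton {E : Set ℕ} {a : ℕ} : [a] ∈ words E ↔ a ∈ E := by
  simp [words]

lemma IsConformal.measure_cyl_append {E : Set ℕ} {δ : ℝ} {μ : Measure ℝ} (hE : 0 ∉ E)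
    (hδ : 0 ≤ δ) (hμ : IsConformal E δ μ) {ω η : List ℕ} (hω : ω ∈ words E) (hη : η ∈ words E) :
    μ (cyl (ω ++ η)) ≤ ENNReal.ofReal (4 ^ (2 * δ)) * (μ (cyl ω) * μ (cyl η)) ∧
      μ (cyl ω) * μ (cyl η) ≤ ENNReal.ofReal (4 ^ (2 * δ)) * μ (cyl (ω ++ η)) := by
  have pω := cfDen_pos (one_le_of_mem_words hE hω)
  have pη := cfDen_pos (one_le_of_mem_words hE hη)
  have hb := cfDen_append_bounds (one_le_of_mem_words hE hω) (one_le_of_mem_words hE hη)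
  have bω := hμ.measure_cyl_bounds hE hδ hω
  have bη := hμ.measure_cyl_bounds hE hδ hη
  have bωη := hμ.measure_cyl_bounds hE hδ (words_append.2 ⟨hω, hη⟩)
  have pωη : 0 < cfDen (ω ++ η) := lt_of_lt_of_le (by positivity) hb.1
  have h4 : (4 : ℝ) ^ (2 * δ) * 4 ^ (-(2 * δ)) = 1 := by
    rw [← Real.rpow_add (by norm_num)]
    simp
  constructor
  · refine bωη.2.trans (le_trans ?_ (mul_le_mul_right (mul_le_mul' bω.1 bη.1) _))
    rw [← ENNReal.ofReal_mul (by positivity), ← ENNReal.ofReal_mul (by positivity),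
      ← Real.mul_rpow (by positivity) (by positivity),
      show 2 * cfDen ω * (2 * cfDen η) = 4 * (cfDen ω * cfDen η) by ring,
      Real.mul_rpow (by positivity) (by positivity), ← mul_assoc, h4, one_mul]
    exact ENNReal.ofReal_le_ofReal
      (Real.rpow_le_rpow_of_nonpos (by positivity) hb.1 (by linarith))
  · refine (mul_le_mul' bω.2 bη.2).trans (le_trans ?_ (mul_le_mul_right bωη.1 _))
    rw [← ENNReal.ofReal_mul (by positivity), ← ENNReal.ofReal_mul (by positivity),
      ← Real.mul_rpow (by positivity) (by positivity)]
    refine ENNReal.ofReal_le_ofReal ?_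
    calc (cfDen ω * cfDen η) ^ (-(2 * δ))
        = 4 ^ (2 * δ) * (4 * (cfDen ω * cfDen η)) ^ (-(2 * δ)) := by
          rw [Real.mul_rpow (by positivity : (0 : ℝ) ≤ 4) (by positivity), ← mul_assoc, h4,
            one_mul]
      _ ≤ 4 ^ (2 * δ) * (2 * cfDen (ω ++ η)) ^ (-(2 * δ)) := by
          gcongr 1
          exact Real.rpow_le_rpow_of_nonpos (by positivity) (by linarith) (by linarith)

lemma eq_of_mem_cyl {ω τ : List ℕ} (hω : ∀ a ∈ ω, 1 ≤ a) (hτ : ∀ a ∈ τ, 1 ≤ a)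
    (h : ω.length = τ.length) {x : ℝ} (hx : Irrational x) (h1 : x ∈ cyl ω) (h2 : x ∈ cyl τ) :
    ω = τ :=
  (comparable_of_mem_cyl hω hτ hx h1 h2).elim (fun p => p.eq_of_length h)
    fun p => (p.eq_of_length h.symm).symm

lemma cfDen_le_of_extends {ω τ : List ℕ} (hτ : ∀ a ∈ τ, 1 ≤ a) (h : ω <+: τ) :
    cfDen ω * (τ.length - ω.length : ℝ) ≤ cfDen τ ∧ cfDen ω ≤ cfDen τ := by
  obtain ⟨η, rfl⟩ := h
  have hω : ∀ a ∈ ω, 1 ≤ a := fun a ha => hτ a (by simp [ha])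
  have hη : ∀ a ∈ η, 1 ≤ a := fun a ha => hτ a (by simp [ha])
  have h1 := (cfDen_append_bounds hω hη).1
  have h2 := length_le_cfDen hη
  have h3 := cfDen_pos hω
  have h4 := (cfDenPrev_bounds hη).2.2
  rw [List.length_append]
  push_cast
  constructor <;> nlinarith

/-- Sets subordinate to cylinders with comparable continuants have bounded multiplicity. -/
lemma IsConformal.tsum_measure_le {E : Set ℕ} {δ : ℝ} {μ : Measure ℝ} (hE : 0 ∉ E)
    (hδ : 0 ≤ δ) (hμ : IsConformal E δ μ) {ι : Type*} [Countable ι] (g : ι → List ℕ)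
    (hg : ∀ i, g i ∈ words E) (S : ι → Set ℝ) (hS : ∀ i, MeasurableSet (S i))
    (hSg : ∀ i, S i ⊆ cyl (g i))
    (hdis : ∀ i j, (g i).length = (g j).length → ∀ x, Irrational x → x ∈ S i → x ∈ S j → i = j)
    {M D : ℝ} (hD : 0 ≤ D) (hM : ∀ i, M ≤ cfDen (g i)) (hDM : ∀ i, cfDen (g i) < D * M) :
    ∑' i, μ (S i) ≤ ⌈D⌉₊ * μ (⋃ i, S i) := by
  classical
  have key : ∀ x, Irrational x → ∀ i j, x ∈ S i → x ∈ S j →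
      (g j).length < (g i).length + ⌈D⌉₊ := by
    intro x hx i j hi hj
    by_contra! hcon
    have hDpos : (0 : ℝ) < D := by
      have h1 := cfDen_pos (one_le_of_mem_words hE (hg i))
      rcases hD.eq_or_lt with h | h
      · have := hDM i
        rw [← h, zero_mul] at this
        linarith
      · exact h
    have hceil := Nat.ceil_pos.2 hDpos
    have hp : g i <+: g j := by
      rcases comparable_of_mem_cyl (one_le_of_mem_words hE (hg i)) (one_le_of_mem_words hE (hg j)) hx
        (hSg i hi) (hSg j hj) with h | h
      · exact h
      · have := h.length_le
        omega
    have h1 := (cfDen_le_of_extends (one_le_of_mem_words hE (hg j)) hp).1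
    have h2 := cfDen_pos (one_le_of_mem_words hE (hg i))
    have h3 : ((g i).length : ℝ) + ⌈D⌉₊ ≤ (g j).length := by exact_mod_cast hcon
    have h4 := Nat.le_ceil D
    have h5 := hDM j
    have h6 := hM i
    nlinarith
  calc ∑' i, μ (S i) = ∑' i, ∫⁻ x, (S i).indicator 1 x ∂μ := by
        simp_rw [lintegral_indicator_one (hS _)]
    _ = ∫⁻ x, ∑' i, (S i).indicator 1 x ∂μ :=
        (lintegral_tsum fun i => (measurable_one.indicator (hS i)).aemeasurable).symm
    _ ≤ ∫⁻ x, ⌈D⌉₊ * (⋃ i, S i).indicator 1 x ∂μ := by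
        refine lintegral_mono_ae ?_
        filter_upwards [hμ.ae_irrational hE hδ] with x hx
        by_cases hxU : x ∈ ⋃ i, S i
        swap
        · have : ∀ i, x ∉ S i := fun i hi => hxU (mem_iUnion.2 ⟨i, hi⟩)
          simp [this]
        rw [indicator_of_mem hxU, Pi.one_apply, mul_one, ENNReal.tsum_eq_iSup_sum]
        refine iSup_le fun s => ?_
        have e : ∑ i ∈ s, (S i).indicator (1 : ℝ → ℝ≥0∞) x =
            ((s.filter fun i => x ∈ S i).card : ℝ≥0∞) := by
          simp [indicator_apply]
        rw [e, Nat.cast_le]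
        rcases (s.filter fun i => x ∈ S i).eq_empty_or_nonempty with h | h
        · simp [h]
        obtain ⟨i, hi, hmin⟩ := Finset.exists_min_image _ (fun i => (g i).length) h
        have hi' := (Finset.mem_filter.1 hi).2
        have hcard := Finset.card_le_card_of_injOn (s := s.filter fun i => x ∈ S i)
          (t := Finset.Ico (g i).length ((g i).length + ⌈D⌉₊)) (fun i => (g i).length)
          (fun j hj => Finset.mem_coe.2 (Finset.mem_Ico.2 ⟨hmin j hj, key x hx i j hi'
            (Finset.mem_filter.1 hj).2⟩))
          (fun j hj k hk hjk => hdis j k hjk x hx (Finset.mem_filter.1 hj).2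
            (Finset.mem_filter.1 hk).2)
        simpa using hcard
    _ = ⌈D⌉₊ * μ (⋃ i, S i) := by
        rw [lintegral_const_mul _ (measurable_one.indicator (MeasurableSet.iUnion hS)),
          lintegral_indicator_one (MeasurableSet.iUnion hS)]

lemma IsConformal.tsum_cyl_snoc_le {E : Set ℕ} {δ : ℝ} {μ : Measure ℝ} (hE : 0 ∉ E)
    (hδ : 0 ≤ δ) (hμ : IsConformal E δ μ) {V : Set (List ℕ)} (hV : V ⊆ words E) {J : Set ℕ}
    (hJ : J ⊆ E) {M D : ℝ} (hD : 0 ≤ D) (hM : ∀ τ ∈ V, M ≤ cfDen τ)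
    (hDM : ∀ τ ∈ V, cfDen τ < D * M) :
    ∑' p : V × J, μ (cyl ((p.1 : List ℕ) ++ [(p.2 : ℕ)])) ≤
      ⌈D⌉₊ * μ (⋃ τ ∈ V, ⋃ a ∈ J, cyl (τ ++ [a])) := by
  have hw : ∀ p : V × J, (p.1 : List ℕ) ++ [(p.2 : ℕ)] ∈ words E := fun p =>
    words_append.2 ⟨hV p.1.2, words_singleton.2 (hJ p.2.2)⟩
  refine (hμ.tsum_measure_le hE hδ (fun p : V × J => (p.1 : List ℕ)) (fun p => hV p.1.2)
    (fun p => cyl ((p.1 : List ℕ) ++ [(p.2 : ℕ)]))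
    (fun p => measurableSet_cyl (one_le_of_mem_words hE (hw p)))
    (fun p => cyl_append_subset (one_le_of_mem_words hE (words_singleton.2 (hJ p.2.2)))) ?_ hD
    (fun p => hM _ p.1.2) (fun p => hDM _ p.1.2)).trans ?_
  · intro p p' hl x hx h1 h2
    have := eq_of_mem_cyl (one_le_of_mem_words hE (hw p)) (one_le_of_mem_words hE (hw p'))
      (by simpa using hl) hx h1 h2
    rw [← List.concat_eq_append, ← List.concat_eq_append] at this
    obtain ⟨e1, e2⟩ := List.concat_inj.1 this
    exact Prod.ext (Subtype.ext e1) (Subtype.ext e2)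
  · gcongr
    refine iUnion_subset fun p => ?_
    intro x hx
    simp only [mem_iUnion]
    exact ⟨p.1, p.1.2, p.2, p.2.2, hx⟩

lemma IsConformal.tsum_cyl_le {E : Set ℕ} {δ : ℝ} {μ : Measure ℝ} (hE : 0 ∉ E)
    (hδ : 0 ≤ δ) (hμ : IsConformal E δ μ) {V : Set (List ℕ)} (hV : V ⊆ words E) {M D : ℝ}
    (hD : 0 ≤ D) (hM : ∀ τ ∈ V, M ≤ cfDen τ) (hDM : ∀ τ ∈ V, cfDen τ < D * M) {U : Set ℝ}
    (hU : MeasurableSet U) :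
    ∑' τ : V, μ (cyl (τ : List ℕ) ∩ U) ≤ ⌈D⌉₊ * μ U := by
  refine (hμ.tsum_measure_le hE hδ (fun τ : V => (τ : List ℕ)) (fun τ => hV τ.2)
    (fun τ => cyl (τ : List ℕ) ∩ U)
    (fun τ => (measurableSet_cyl (one_le_of_mem_words hE (hV τ.2))).inter hU)
    (fun τ => inter_subset_left) ?_ hD (fun τ => hM _ τ.2) (fun τ => hDM _ τ.2)).trans ?_
  · intro τ τ' hl x hx h1 h2
    exact Subtype.ext (eq_of_mem_cyl (one_le_of_mem_words hE (hV τ.2))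
      (one_le_of_mem_words hE (hV τ'.2)) hl hx h1.1 h2.1)
  · gcongr
    exact iUnion_subset fun τ => inter_subset_right

lemma mem_W_iff {lam : ℝ} (hlam : 1 < lam) {k : ℕ} {ω : List ℕ} (hω : ∀ a ∈ ω, 1 ≤ a) :
    ω ∈ W lam k ↔ √lam ^ k ≤ cfDen ω ∧ cfDen ω < √lam ^ (k + 1) := by
  have hp := cfDen_pos hω
  have hs : 0 < √lam := Real.sqrt_pos.2 (by linarith)
  have e : ∀ n : ℕ, lam ^ (-(n : ℝ)) = ((√lam ^ n) ^ 2)⁻¹ := by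
    intro n
    rw [Real.rpow_neg (by linarith), Real.rpow_natCast, ← pow_mul, mul_comm n 2, pow_mul,
      Real.sq_sqrt (by linarith)]
  have e' : (-(k : ℝ) - 1) = -((k + 1 : ℕ) : ℝ) := by
    push_cast
    ring
  simp only [W, mem_ofPred_eq]
  rw [derivNorm_eq hω, e', e, e, inv_lt_inv₀ (by positivity) (by positivity),
    inv_le_inv₀ (by positivity) (by positivity), pow_lt_pow_iff_left₀ hp.le (by positivity)
    (by norm_num), pow_le_pow_iff_left₀ (by positivity) hp.le (by norm_num)]
  exact and_comm

lemma derivNorm_singleton {a : ℕ} (ha : 1 ≤ a) : derivNorm [a] = ((a : ℝ) ^ 2)⁻¹ := by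
  rw [derivNorm_eq (by simpa using ha), cfDen_singleton]

lemma AssumptionC.exists_const {E : Set ℕ} {μ : Measure ℝ} {lam : ℝ} (hE : 0 ∉ E)
    (hlam : 1 < lam) (hC : AssumptionC E μ lam) :
    ∃ c : ℝ≥0∞, c ≠ 0 ∧ c ≠ ⊤ ∧ ∀ N : ℝ, 1 ≤ N →
      c * cylMass μ {a ∈ E | N ≤ (a : ℝ)} ≤
        cylMass μ {a ∈ E | N ≤ (a : ℝ) ∧ (a : ℝ) < √lam * N} := by
  obtain ⟨c, C, hc, -, h⟩ := hC
  refine ⟨min c 1, (lt_min hc one_pos).ne', (min_lt_of_right_lt ENNReal.one_lt_top).ne, ?_⟩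
  intro N hN
  have hpos : ∀ a ∈ E, (1 : ℝ) ≤ a := fun a ha => by
    exact_mod_cast Nat.one_le_iff_ne_zero.2 fun h => hE (h ▸ ha)
  have hs : 0 < √lam := Real.sqrt_pos.2 (by linarith)
  have hr := (h (N ^ 2)⁻¹ (by positivity) (inv_le_one_of_one_le₀ (one_le_pow₀ hN))).1
  have e0 : ∀ a ∈ E, (derivNorm [a] ≤ (N ^ 2)⁻¹ ↔ N ≤ (a : ℝ)) := by
    intro a ha
    have h1 := hpos a ha
    rw [derivNorm_singleton (by exact_mod_cast h1), inv_le_inv₀ (by positivity) (by positivity),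
      pow_le_pow_iff_left₀ (by linarith) (by linarith) (by norm_num)]
  have e1 : {a ∈ E | derivNorm [a] ≤ (N ^ 2)⁻¹} = {a ∈ E | N ≤ (a : ℝ)} := by
    ext a
    exact and_congr_right fun ha => e0 a ha
  have e2 : {a ∈ E | lam⁻¹ * (N ^ 2)⁻¹ < derivNorm [a] ∧ derivNorm [a] ≤ (N ^ 2)⁻¹} =
      {a ∈ E | N ≤ (a : ℝ) ∧ (a : ℝ) < √lam * N} := by
    ext a
    refine and_congr_right fun ha => ?_
    have h1 := hpos a ha
    rw [e0 a ha, derivNorm_singleton (by exact_mod_cast h1), ← mul_inv,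
      inv_lt_inv₀ (by positivity) (by positivity), and_comm]
    refine and_congr_right fun _ => ?_
    nth_rewrite 1 [← Real.sq_sqrt (show 0 ≤ lam by linarith)]
    rw [← mul_pow, pow_lt_pow_iff_left₀ (by linarith) (by positivity) (by norm_num)]
  rw [e1, e2] at hr
  exact (mul_le_mul_left (min_le_left _ _) _).trans hr

lemma AssumptionC.exists_mem {E : Set ℕ} {δ : ℝ} {μ : Measure ℝ} {lam : ℝ} (hE : 0 ∉ E)
    (hδ : 0 ≤ δ) (hμ : IsConformal E δ μ) (hlam : 1 < lam) (hC : AssumptionC E μ lam) {b : ℕ}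
    (hb : b ∈ E) {N : ℝ} (hN : 1 ≤ N) (hNb : N ≤ b) :
    ∃ a ∈ E, N ≤ (a : ℝ) ∧ (a : ℝ) < √lam * N := by
  obtain ⟨c, hc0, -, h⟩ := hC.exists_const hE hlam
  by_contra! hcon
  have e : {a ∈ E | N ≤ (a : ℝ) ∧ (a : ℝ) < √lam * N} = ∅ := by
    ext a
    simp only [mem_ofPred_eq, mem_empty_iff_false, iff_false, not_and, not_lt]
    exact hcon a
  have h1 := h N hN
  rw [e, show cylMass μ ∅ = 0 by simp [cylMass], nonpos_iff_eq_zero, mul_eq_zero] at h1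
  have h2 := ENNReal.tsum_eq_zero.1 (h1.resolve_left hc0) ⟨b, hb, hNb⟩
  exact hμ.measure_cyl_ne_zero hE hδ (words_singleton.2 hb) h2

lemma cylMass_mono (μ : Measure ℝ) {J J' : Set ℕ} (h : J ⊆ J') : cylMass μ J ≤ cylMass μ J' :=
  ENNReal.tsum_mono_subtype (fun a : ℕ => μ (cyl [a])) h

lemma le_cylMass (μ : Measure ℝ) {J : Set ℕ} {a : ℕ} (h : a ∈ J) :
    μ (cyl [a]) ≤ cylMass μ J :=
  ENNReal.le_tsum (f := fun a : J => μ (cyl [(a : ℕ)])) ⟨a, h⟩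

lemma IsConformal.cylMass_le {E : Set ℕ} {δ : ℝ} {μ : Measure ℝ} (hE : 0 ∉ E) (hδ : 0 ≤ δ)
    (hμ : IsConformal E δ μ) : cylMass μ E ≤ 2 := by
  have := hμ.1
  have h := hμ.tsum_measure_le hE hδ (fun _ : E => []) (fun _ => by simp [words])
    (fun a : E => cyl [(a : ℕ)])
    (fun a => measurableSet_cyl (one_le_of_mem_words hE (words_singleton.2 a.2)))
    (fun a => cyl_append_subset (ω := []) (one_le_of_mem_words hE (words_singleton.2 a.2)))
    (fun a b _ x hx h1 h2 => Subtype.ext (by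
      simpa using eq_of_mem_cyl (one_le_of_mem_words hE (words_singleton.2 a.2))
        (one_le_of_mem_words hE (words_singleton.2 b.2)) rfl hx h1 h2))
    (M := 1) (D := 2) (by norm_num) (by simp) (by simp)
  refine h.trans ((mul_le_mul_right prob_le_one _).trans ?_)
  simp

/-- A word with large continuant has a prefix at which the continuant first reaches `L`. -/
lemma exists_crossing {L : ℝ} (hL : 1 < L) {ω : List ℕ} (h : L ≤ cfDen ω) :
    ∃ τ a η, ω = τ ++ [a] ++ η ∧ cfDen τ < L ∧ L ≤ cfDen (τ ++ [a]) := by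
  induction ω using List.reverseRecOn with
  | nil =>
    rw [cfDen_nil] at h
    linarith
  | append_singleton ω a ih =>
    by_cases h' : L ≤ cfDen ω
    · obtain ⟨τ, b, η, rfl, h1, h2⟩ := ih h'
      exact ⟨τ, b, η ++ [a], by simp, h1, h2⟩
    · exact ⟨ω, a, [], by simp, not_le.1 h', h⟩

lemma IsConformal.one_le_tsum_crossing {E : Set ℕ} {δ : ℝ} {μ : Measure ℝ} (hE : 0 ∉ E)
    (hδ : 0 ≤ δ) (hμ : IsConformal E δ μ) {L : ℝ} (hL : 1 < L) :
    1 ≤ ∑' ω : {ω | ω ∈ words E ∧ cfDen ω < L}, ∑' a : {a ∈ E | L ≤ cfDen ((ω : List ℕ) ++ [a])},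
      μ (cyl ((ω : List ℕ) ++ [(a : ℕ)])) := by
  have := hμ.1
  calc 1 = μ univ := measure_univ.symm
    _ ≤ μ (⋃ ω : {ω | ω ∈ words E ∧ cfDen ω < L},
        ⋃ a : {a ∈ E | L ≤ cfDen ((ω : List ℕ) ++ [a])}, cyl ((ω : List ℕ) ++ [(a : ℕ)])) := by
      refine measure_mono_ae ?_
      filter_upwards [hμ.ae_exists_word hE hδ ⌈L⌉₊] with x hx _
      obtain ⟨ω, hω, hl, hxω⟩ := hx
      have h1 := length_le_cfDen (one_le_of_mem_words hE hω)
      rw [hl] at h1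
      obtain ⟨τ, a, η, rfl, h2, h3⟩ := exists_crossing hL ((Nat.le_ceil L).trans h1)
      have hw := words_append.1 hω
      have hw' := words_append.1 hw.1
      have hxc := cyl_append_subset (one_le_of_mem_words hE hw.2) hxω
      exact mem_iUnion.2 ⟨⟨τ, hw'.1, h2⟩, mem_iUnion.2 ⟨⟨a, words_singleton.1 hw'.2, h3⟩, hxc⟩⟩
    _ ≤ _ := (measure_iUnion_le _).trans (ENNReal.tsum_le_tsum fun ω => measure_iUnion_le _)

/-- A uniform proportion of the limit set has a convergent with denominator in `[L, D L)`. -/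
lemma IsConformal.exists_one_le_mul_tsum {E : Set ℕ} {δ : ℝ} {μ : Measure ℝ} {lam : ℝ}
    (hE : 0 ∉ E) (hδ : 0 ≤ δ) (hμ : IsConformal E δ μ) (hlam : 1 < lam)
    (hC : AssumptionC E μ lam) {a₀ : ℕ} (ha₀ : a₀ ∈ E) {D : ℝ} (hD : √lam ≤ D)
    (hD' : (a₀ : ℝ) + 1 ≤ D) :
    ∃ K : ℝ≥0∞, K ≠ ⊤ ∧ ∀ L : ℝ, 1 < L →
      1 ≤ K * ∑' τ : {τ | τ ∈ words E ∧ L ≤ cfDen τ ∧ cfDen τ < D * L}, μ (cyl (τ : List ℕ)) := by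
  obtain ⟨c, hc0, hc, hcN⟩ := hC.exists_const hE hlam
  have hs : 1 ≤ √lam := Real.one_le_sqrt.2 hlam.le
  have hm := hμ.measure_cyl_ne_zero hE hδ (words_singleton.2 ha₀)
  have := hμ.1
  have hm' : μ (cyl [a₀]) ≠ ⊤ := measure_ne_top _ _
  set K₁ : ℝ≥0∞ := c⁻¹ + 2 * (μ (cyl [a₀]))⁻¹ with hK₁
  set K₂ : ℝ≥0∞ := ENNReal.ofReal (4 ^ (2 * δ)) with hK₂
  have claim : ∀ L : ℝ, ∀ ω ∈ words E, cfDen ω < L →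
      cylMass μ {a ∈ E | L ≤ cfDen (ω ++ [a])} ≤
        K₁ * cylMass μ {a ∈ E | L ≤ cfDen (ω ++ [a]) ∧ cfDen (ω ++ [a]) < D * L} := by
    intro L ω hω hL
    obtain ⟨b0, b1, b2⟩ := cfDenPrev_bounds (one_le_of_mem_words hE hω)
    have hq : 0 < cfDen ω := by linarith
    rcases le_or_gt 1 ((L - cfDenPrev ω) / cfDen ω) with hN | hN
    · have e : {a ∈ E | L ≤ cfDen (ω ++ [a])} =
          {a ∈ E | (L - cfDenPrev ω) / cfDen ω ≤ (a : ℝ)} := by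
        ext a
        refine and_congr_right fun _ => ?_
        rw [cfDen_snoc, div_le_iff₀ hq, sub_le_iff_le_add]
      rw [e]
      calc _ = c⁻¹ * (c * cylMass μ {a ∈ E | (L - cfDenPrev ω) / cfDen ω ≤ (a : ℝ)}) := by
            rw [← mul_assoc, ENNReal.inv_mul_cancel hc0 hc, one_mul]
        _ ≤ K₁ * cylMass μ {a ∈ E | L ≤ cfDen (ω ++ [a]) ∧ cfDen (ω ++ [a]) < D * L} := by
            refine mul_le_mul' le_self_add ((hcN _ hN).trans (cylMass_mono μ ?_))
            rintro a ⟨ha, h1, h2⟩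
            have h1' : a ∈ {a ∈ E | L ≤ cfDen (ω ++ [a])} := e ▸ ⟨ha, h1⟩
            refine ⟨ha, h1'.2, ?_⟩
            rw [cfDen_snoc]
            rw [mul_div_assoc', lt_div_iff₀ hq] at h2
            nlinarith
    · have hmem : a₀ ∈ {a ∈ E | L ≤ cfDen (ω ++ [a]) ∧ cfDen (ω ++ [a]) < D * L} := by
        rw [div_lt_one hq] at hN
        have ha1 : (1 : ℝ) ≤ a₀ := by
          exact_mod_cast one_le_of_mem_words hE (words_singleton.2 ha₀) a₀ (by simp)
        refine ⟨ha₀, ?_, ?_⟩ <;> rw [cfDen_snoc] <;> nlinarith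
      calc _ ≤ cylMass μ E := cylMass_mono μ fun a ha => ha.1
        _ ≤ 2 * ((μ (cyl [a₀]))⁻¹ * μ (cyl [a₀])) := by
            rw [ENNReal.inv_mul_cancel hm hm', mul_one]
            exact hμ.cylMass_le hE hδ
        _ ≤ _ := by
            rw [← mul_assoc]
            exact mul_le_mul' le_add_self (le_cylMass μ hmem)
  refine ⟨K₂ * K₁ * K₂, by finiteness [ENNReal.inv_ne_top.2 hc0, ENNReal.inv_ne_top.2 hm], ?_⟩
  intro L hL
  refine (hμ.one_le_tsum_crossing hE hδ hL).trans ?_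
  let G : {ω | ω ∈ words E ∧ cfDen ω < L} → Set ℕ := fun ω =>
    {a ∈ E | L ≤ cfDen ((ω : List ℕ) ++ [a]) ∧ cfDen ((ω : List ℕ) ++ [a]) < D * L}
  have hstep : ∀ ω : {ω | ω ∈ words E ∧ cfDen ω < L},
      ∑' a : {a ∈ E | L ≤ cfDen ((ω : List ℕ) ++ [a])}, μ (cyl ((ω : List ℕ) ++ [(a : ℕ)])) ≤
        K₂ * K₁ * K₂ * ∑' a : G ω, μ (cyl ((ω : List ℕ) ++ [(a : ℕ)])) := by
    intro ω
    calc _ ≤ ∑' a : {a ∈ E | L ≤ cfDen ((ω : List ℕ) ++ [a])},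
          K₂ * (μ (cyl (ω : List ℕ)) * μ (cyl [(a : ℕ)])) :=
          ENNReal.tsum_le_tsum fun a =>
            (hμ.measure_cyl_append hE hδ ω.2.1 (words_singleton.2 a.2.1)).1
      _ = K₂ * (μ (cyl (ω : List ℕ)) * cylMass μ {a ∈ E | L ≤ cfDen ((ω : List ℕ) ++ [a])}) := by
          rw [ENNReal.tsum_mul_left, ENNReal.tsum_mul_left, cylMass]
      _ ≤ K₂ * (μ (cyl (ω : List ℕ)) * (K₁ * cylMass μ (G ω))) := by
          gcongr
          exact claim L ω ω.2.1 ω.2.2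
      _ = K₂ * K₁ * ∑' a : G ω, μ (cyl (ω : List ℕ)) * μ (cyl [(a : ℕ)]) := by
          rw [ENNReal.tsum_mul_left, cylMass]
          ring
      _ ≤ K₂ * K₁ * ∑' a : G ω, K₂ * μ (cyl ((ω : List ℕ) ++ [(a : ℕ)])) := by
          refine mul_le_mul_right (ENNReal.tsum_le_tsum fun a => ?_) _
          exact (hμ.measure_cyl_append hE hδ ω.2.1 (words_singleton.2 a.2.1)).2
      _ = _ := by
          rw [ENNReal.tsum_mul_left]
          ring
  refine (ENNReal.tsum_le_tsum hstep).trans ?_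
  rw [ENNReal.tsum_mul_left, ← ENNReal.tsum_sigma fun ω (a : G ω) =>
    μ (cyl ((ω : List ℕ) ++ [(a : ℕ)]))]
  gcongr
  let F : (Σ ω, G ω) → {τ | τ ∈ words E ∧ L ≤ cfDen τ ∧ cfDen τ < D * L} := fun p =>
    ⟨(p.1 : List ℕ) ++ [(p.2 : ℕ)],
      words_append.2 ⟨p.1.2.1, words_singleton.2 p.2.2.1⟩, p.2.2.2⟩
  have hF : Function.Injective F := by
    rintro ⟨⟨ω, hω⟩, ⟨a, ha⟩⟩ ⟨⟨ω', hω'⟩, ⟨a', ha'⟩⟩ h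
    have h' : ω ++ [a] = ω' ++ [a'] := congrArg Subtype.val h
    rw [← List.concat_eq_append, ← List.concat_eq_append] at h'
    obtain ⟨rfl, rfl⟩ := List.concat_inj.1 h'
    rfl
  exact ENNReal.tsum_comp_le_tsum_of_injective hF fun τ => μ (cyl (τ : List ℕ))

/-- Gaps between continuants can be filled using two letters of comparable size. -/
lemma exists_append_mem_Ico {E : Set ℕ} (hE : 0 ∉ E) {a b : ℕ} (ha : a ∈ E) (hb : b ∈ E)
    (hab : a < b) {t L : ℝ} (hat : (a : ℝ) < t) (hbt : (b : ℝ) ≤ t * a) {τ : List ℕ}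
    (hτ : τ ∈ words E) (hτL : (a + 1) * cfDen τ < L) :
    ∃ η, τ ++ η ∈ words E ∧ L ≤ cfDen (τ ++ η) ∧ cfDen (τ ++ η) < t * L := by
  have ha1 : (1 : ℝ) ≤ a := by
    exact_mod_cast one_le_of_mem_words hE (words_singleton.2 ha) a (by simp)
  have hab' : (a : ℝ) + 1 ≤ b := by exact_mod_cast hab
  have hw : ∀ n, τ ++ List.replicate n a ∈ words E := fun n =>
    words_append.2 ⟨hτ, fun c hc => (List.eq_of_mem_replicate hc) ▸ ha⟩
  have hex : ∃ n, L ≤ cfDen (τ ++ List.replicate n a) := by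
    refine ⟨⌈L⌉₊, (Nat.le_ceil L).trans
      (le_trans ?_ (length_le_cfDen (one_le_of_mem_words hE (hw _))))⟩
    rw [List.length_append, List.length_replicate]
    exact_mod_cast Nat.le_add_left _ _
  obtain ⟨t0, t1, t2⟩ := cfDenPrev_bounds (one_le_of_mem_words hE hτ)
  classical
  have hfind := Nat.find_spec hex
  have hmin := fun m => Nat.find_min hex (m := m)
  generalize Nat.find hex = m at hfind hmin
  match m, hfind, hmin with
  | 0, hfind, _ =>
    simp only [List.replicate_zero, List.append_nil] at hfind
    nlinarith
  | 1, hfind, _ =>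
    rw [List.replicate_one, cfDen_snoc] at hfind
    nlinarith
  | n + 2, hfind, hmin =>
    have hw1 := one_le_of_mem_words hE (hw n)
    have hn := hmin (n + 1) (by omega)
    rw [List.replicate_succ', ← List.append_assoc, cfDen_snoc, not_le] at hn
    have e2 : τ ++ List.replicate (n + 2) a = τ ++ List.replicate n a ++ [a] ++ [a] := by
      rw [List.replicate_succ', List.replicate_succ']
      simp
    have e := cfDen_snoc (ω := τ ++ List.replicate n a ++ [a]) (a := a)
    rw [← e2, cfDenPrev_snoc, cfDen_snoc] at e
    obtain ⟨b0, b1, b2⟩ := cfDenPrev_bounds hw1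
    by_cases hlt : cfDen (τ ++ List.replicate (n + 2) a) < t * L
    · exact ⟨_, hw _, hfind, hlt⟩
    · rw [e] at hlt
      generalize hq : cfDen (τ ++ List.replicate n a) = q at *
      generalize hd : cfDenPrev (τ ++ List.replicate n a) = d at *
      refine ⟨List.replicate n a ++ [b], ?_, ?_, ?_⟩
      · rw [← List.append_assoc]
        exact words_append.2 ⟨hw n, words_singleton.2 hb⟩
      all_goals rw [← List.append_assoc, cfDen_snoc, hq, hd]
      · have h1 : a * L ≤ t * L := mul_le_mul_of_nonneg_right hat.le (by nlinarith)
        have h2 := mul_nonneg (sub_nonneg.2 ha1) (sub_nonneg.2 hn.le)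
        have h3 : (a + 1) * q ≤ b * q := mul_le_mul_of_nonneg_right hab' (by linarith)
        nlinarith
      · have h1 : b * (a * q + d) < b * L := mul_lt_mul_of_pos_left hn (by linarith)
        have h2 : b * L ≤ t * a * L := mul_le_mul_of_nonneg_right hbt (by nlinarith)
        have h3 : a * d ≤ b * d := mul_le_mul_of_nonneg_right (by linarith) b0
        refine lt_of_mul_lt_mul_left (a := (a : ℝ)) ?_ (by linarith)
        nlinarith

lemma IsConformal.exists_one_le_mul_tsum_of_gap {E : Set ℕ} {δ : ℝ} {μ : Measure ℝ} {lam : ℝ}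
    (hE : 0 ∉ E) (hδ : 0 ≤ δ) (hμ : IsConformal E δ μ) (hlam : 1 < lam)
    (hC : AssumptionC E μ lam) {a b : ℕ} (ha : a ∈ E) (hb : b ∈ E) (hab : a < b)
    (hat : (a : ℝ) < √lam) (hta : √lam < a + 1) (hbt : (b : ℝ) ≤ √lam * a) :
    ∃ K : ℝ≥0∞, K ≠ ⊤ ∧ ∀ l : ℕ, 2 ≤ l →
      1 ≤ K * ∑' τ : ↥(W lam l ∩ words E), μ (cyl (τ : List ℕ)) := by
  obtain ⟨K, hK, h⟩ := hμ.exists_one_le_mul_tsum hE hδ hlam hC ha hta.le le_rfl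
  have hb' : (a : ℝ) + 1 ≤ b := by exact_mod_cast hab
  have ha1 : (1 : ℝ) ≤ a := by
    exact_mod_cast one_le_of_mem_words hE (words_singleton.2 ha) a (by simp)
  have ha2 : (2 : ℝ) ≤ a := by
    have : 2 ≤ a := by
      by_contra! hcon
      have h1 : (a : ℝ) = 1 := by
        refine le_antisymm ?_ ha1
        exact_mod_cast Nat.lt_succ_iff.1 hcon
      rw [h1] at hb' hbt hta
      linarith
    exact_mod_cast this
  set t := √lam with ht
  set R : ℝ := t * (a + 1) ^ 2 with hR
  refine ⟨(K + 1) * (ENNReal.ofReal ((2 * R) ^ (2 * δ)) * ⌈(a : ℝ) + 1⌉₊), by finiteness, ?_⟩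
  intro l hl
  have hL : (a : ℝ) + 1 < t ^ l :=
    lt_of_lt_of_le (by nlinarith) (pow_le_pow_right₀ (by linarith) hl)
  set M : ℝ := t ^ l / (a + 1) ^ 2 with hM
  have hML : (a + 1) * ((a + 1) * M) = t ^ l := by
    rw [hM]
    field_simp
  have hMpos : 0 < M := by positivity
  set V : Set (List ℕ) := {τ | τ ∈ words E ∧ M ≤ cfDen τ ∧ cfDen τ < (a + 1) * M} with hV
  set U : Set ℝ := ⋃ σ ∈ W lam l ∩ words E, cyl σ with hU
  have hUm : MeasurableSet U := MeasurableSet.biUnion (to_countable _) fun σ hσ =>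
    measurableSet_cyl (one_le_of_mem_words hE hσ.2)
  have h1 : 1 ≤ (K + 1) * ∑' τ : V, μ (cyl (τ : List ℕ)) := by
    rcases lt_or_ge 1 M with h1 | h1
    · exact (h M h1).trans (mul_le_mul_left le_self_add _)
    · have hmem : [] ∈ V := by
        refine ⟨by simp [words], by simpa using h1, ?_⟩
        rw [cfDen_nil]
        nlinarith
      have h2 := ENNReal.le_tsum (f := fun τ : V => μ (cyl (τ : List ℕ))) ⟨[], hmem⟩
      simp only [hμ.measure_cyl_nil hE] at h2
      exact (one_mul (1 : ℝ≥0∞)).symm.le.trans (mul_le_mul' le_add_self h2)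
  have h2 : ∀ τ : V, μ (cyl (τ : List ℕ)) ≤
      ENNReal.ofReal ((2 * R) ^ (2 * δ)) * μ (cyl (τ : List ℕ) ∩ U) := by
    rintro ⟨τ, hτ, hτ1, hτ2⟩
    obtain ⟨η, hw, hη1, hη2⟩ := exists_append_mem_Ico hE ha hb hab hat hbt hτ
      (L := t ^ l) (by nlinarith)
    have hp := one_le_of_mem_words hE hw
    have hσ : τ ++ η ∈ W lam l ∩ words E :=
      ⟨(mem_W_iff hlam hp).2 ⟨hη1, by rwa [pow_succ']⟩, hw⟩
    refine (hμ.measure_cyl_le_of_cfDen_le hE hδ hw hτ (R := R) (by positivity) ?_).trans ?_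
    · refine hη2.le.trans ?_
      rw [hR, ← hML, mul_assoc]
      refine mul_le_mul_of_nonneg_left ?_ (by linarith)
      rw [← mul_assoc, ← sq]
      gcongr
    · refine mul_le_mul_right (measure_mono (subset_inter ?_ ?_)) _
      · exact cyl_append_subset (one_le_of_mem_words hE (words_append.1 hw).2)
      · exact subset_biUnion_of_mem (u := fun σ => cyl σ) hσ
  calc 1 ≤ (K + 1) * ∑' τ : V, μ (cyl (τ : List ℕ)) := h1
    _ ≤ (K + 1) * (ENNReal.ofReal ((2 * R) ^ (2 * δ)) * (⌈(a : ℝ) + 1⌉₊ * μ U)) := by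
        refine mul_le_mul_right ((ENNReal.tsum_le_tsum h2).trans ?_) _
        rw [ENNReal.tsum_mul_left]
        exact mul_le_mul_right (hμ.tsum_cyl_le hE hδ (fun τ hτ => hτ.1) (by positivity)
          (fun τ hτ => hτ.2.1) (fun τ hτ => hτ.2.2) hUm) _
    _ ≤ (K + 1) * (ENNReal.ofReal ((2 * R) ^ (2 * δ)) * (⌈(a : ℝ) + 1⌉₊ *
          ∑' τ : ↥(W lam l ∩ words E), μ (cyl (τ : List ℕ)))) := by
        gcongr
        exact measure_biUnion_le μ (to_countable _) _
    _ = _ := by ring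

lemma IsConformal.measure_cyl_eq_one {E : Set ℕ} {δ : ℝ} {μ : Measure ℝ} (hE : 0 ∉ E)
    (hδ : 0 ≤ δ) (hμ : IsConformal E δ μ) {a : ℕ} (h : ∀ b ∈ E, b = a) {τ : List ℕ}
    (hτ : τ ∈ words E) : μ (cyl τ) = 1 := by
  have := hμ.1
  refine (prob_compl_eq_zero_iff (measurableSet_cyl (one_le_of_mem_words hE hτ))).1 ?_
  have hae : ∀ᵐ x ∂μ, x ∈ cyl τ := by
    filter_upwards [hμ.ae_exists_word hE hδ τ.length] with x ⟨ω, hω, hl, hx⟩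
    rw [List.eq_replicate_of_mem fun b hb => h b (hτ b hb), ← hl,
      ← List.eq_replicate_of_mem fun b hb => h b (hω b hb)]
    exact hx
  exact hae

lemma IsConformal.nonempty {E : Set ℕ} {δ : ℝ} {μ : Measure ℝ} (hE : 0 ∉ E)
    (hδ : 0 ≤ δ) (hμ : IsConformal E δ μ) : E.Nonempty := by
  have := hμ.1
  obtain ⟨x, ω, hω, hl, -⟩ := (hμ.ae_exists_word hE hδ 1).exists
  obtain ⟨a, rfl⟩ := List.length_eq_one_iff.1 hl
  exact ⟨a, words_singleton.1 hω⟩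

/-- The cylinders of level `l` carry mass bounded below, as soon as there is one. -/
lemma IsConformal.exists_one_le_mul_tsum_W {E : Set ℕ} {δ : ℝ} {μ : Measure ℝ} {lam : ℝ}
    (hE : 0 ∉ E) (hδ : 0 ≤ δ) (hμ : IsConformal E δ μ) (hlam : 1 < lam)
    (hC : AssumptionC E μ lam) :
    ∃ K : ℝ≥0∞, K ≠ ⊤ ∧ ∀ l : ℕ, (W lam l ∩ words E).Nonempty →
      1 ≤ K * ∑' τ : ↥(W lam l ∩ words E), μ (cyl (τ : List ℕ)) := by
  classical
  have hs : 1 < √lam := Real.lt_sqrt_of_sq_lt (by simpa using hlam)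
  have hle : ∀ {l : ℕ} {τ : List ℕ}, τ ∈ W lam l ∩ words E →
      μ (cyl τ) ≤ ∑' τ : ↥(W lam l ∩ words E), μ (cyl (τ : List ℕ)) := fun {l τ} hτ =>
    ENNReal.le_tsum (f := fun τ : ↥(W lam l ∩ words E) => μ (cyl (τ : List ℕ))) ⟨τ, hτ⟩
  have hnil : [] ∈ W lam 0 ∩ words E :=
    ⟨(mem_W_iff hlam (by simp)).2 (by simpa using hs), by simp [words]⟩
  have hzero : 1 ≤ ∑' τ : ↥(W lam 0 ∩ words E), μ (cyl (τ : List ℕ)) := by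
    simpa only [hμ.measure_cyl_nil hE] using hle hnil
  obtain ⟨a, ha, hmin⟩ : ∃ a ∈ E, ∀ b ∈ E, a ≤ b :=
    ⟨Nat.find (hμ.nonempty hE hδ), Nat.find_spec (hμ.nonempty hE hδ), fun b hb =>
      Nat.find_min' (hμ.nonempty hE hδ) hb⟩
  have ha1 : (1 : ℝ) ≤ a := by
    exact_mod_cast one_le_of_mem_words hE (words_singleton.2 ha) a (by simp)
  rcases le_or_gt ((a : ℝ) + 1) √lam with hcase | hcase
  · obtain ⟨K, hK, h⟩ := hμ.exists_one_le_mul_tsum hE hδ hlam hC ha le_rfl hcase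
    refine ⟨K + 1, by finiteness, fun l _ => ?_⟩
    rcases Nat.eq_zero_or_pos l with rfl | hl
    · exact (one_mul (1 : ℝ≥0∞)).symm.le.trans (mul_le_mul' le_add_self hzero)
    · have e : W lam l ∩ words E = {τ | τ ∈ words E ∧ √lam ^ l ≤ cfDen τ ∧
          cfDen τ < √lam * √lam ^ l} := by
        ext τ
        rw [mem_inter_iff, and_comm]
        refine and_congr_right fun hτ => ?_
        rw [mem_W_iff hlam (one_le_of_mem_words hE hτ), pow_succ']
      rw [e]
      exact (h _ (one_lt_pow₀ hs hl.ne')).trans (mul_le_mul_left le_self_add _)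
  by_cases hex : ∃ b, b ∈ E ∧ a < b
  swap
  · refine ⟨1, by finiteness, fun l ⟨τ, hτ⟩ => ?_⟩
    have := hle hτ
    rwa [hμ.measure_cyl_eq_one hE hδ
      (fun b hb => ((hmin b hb).eq_of_not_lt fun h => hex ⟨b, hb, h⟩).symm) hτ.2,
      ← one_mul (tsum _)] at this
  obtain ⟨b, ⟨hb, hab⟩, hbmin⟩ : ∃ b, (b ∈ E ∧ a < b) ∧ ∀ c ∈ E, a < c → b ≤ c :=
    ⟨Nat.find hex, Nat.find_spec hex, fun c hc h => Nat.find_min' hex ⟨hc, h⟩⟩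
  have hab' : (a : ℝ) + 1 ≤ b := by exact_mod_cast hab
  have hat : (a : ℝ) < √lam := by
    obtain ⟨c, hc, -, h⟩ := hC.exists_mem hE hδ hμ hlam ha le_rfl ha1
    have : (a : ℝ) ≤ c := by exact_mod_cast hmin c hc
    linarith
  have hbt : (b : ℝ) ≤ √lam * a := by
    have : ∀ N : ℝ, a < N → (b : ℝ) ≤ √lam * N := by
      intro N hN
      rcases le_or_gt N b with h | h
      · obtain ⟨c, hc, h1, h2⟩ := hC.exists_mem hE hδ hμ hlam hb (by linarith) h
        have : (b : ℝ) ≤ c := by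
          exact_mod_cast hbmin c hc (by exact_mod_cast hN.trans_le h1)
        linarith
      · nlinarith
    rw [mul_comm, ← div_le_iff₀ (by linarith)]
    refine le_of_forall_gt_imp_ge_of_dense fun N hN => ?_
    rw [div_le_iff₀ (by linarith), mul_comm]
    exact this N hN
  obtain ⟨K, hK, h⟩ := hμ.exists_one_le_mul_tsum_of_gap hE hδ hlam hC ha hb hab hat hcase hbt
  have hbw := words_singleton.2 hb
  have hm := hμ.measure_cyl_ne_zero hE hδ hbw
  have := hμ.1
  refine ⟨1 + (μ (cyl [b]))⁻¹ + K, by finiteness [ENNReal.inv_ne_top.2 hm], fun l _ => ?_⟩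
  match l with
  | 0 =>
    refine (one_mul (1 : ℝ≥0∞)).symm.le.trans (mul_le_mul' ?_ hzero)
    rw [add_assoc]
    exact le_self_add
  | 1 =>
    have hbW : [b] ∈ W lam 1 ∩ words E := by
      refine ⟨(mem_W_iff hlam (one_le_of_mem_words hE hbw)).2 ?_, hbw⟩
      rw [cfDen_singleton, pow_one]
      refine ⟨by linarith, hbt.trans_lt ?_⟩
      rw [pow_two]
      exact mul_lt_mul_of_pos_left hat (by linarith)
    calc 1 = (μ (cyl [b]))⁻¹ * μ (cyl [b]) :=
          (ENNReal.inv_mul_cancel hm (measure_ne_top _ _)).symm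
      _ ≤ _ := mul_le_mul' (le_add_self.trans le_self_add) (hle hbW)
  | l + 2 => exact (h _ (by omega)).trans (mul_le_mul_left le_add_self _)

lemma prefix_of_mem_cyl {ω τ : List ℕ} (hω : ∀ a ∈ ω, 1 ≤ a) (hτ : ∀ a ∈ τ, 1 ≤ a) {a : ℕ}
    (ha : 1 ≤ a) (h : cfDen ω < cfDen τ) {x : ℝ} (hx : Irrational x)
    (h1 : x ∈ cyl (ω ++ [a])) (h2 : x ∈ cyl τ) : ω ++ [a] <+: τ := by
  have ha' : ∀ c ∈ [a], 1 ≤ c := by simpa using ha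
  rcases comparable_of_mem_cyl hω hτ hx (cyl_append_subset ha' h1) h2 with ⟨η, rfl⟩ | hp
  · have hωa : ∀ c ∈ ω ++ [a], 1 ≤ c := by
      intro c hc
      exact (List.mem_append.1 hc).elim (hω c) (ha' c)
    rcases comparable_of_mem_cyl hωa hτ hx h1 h2 with hp | ⟨ζ, hζ⟩
    · exact hp
    · have hη : η ≠ [] := by
        rintro rfl
        simp at h
      have hlen := congrArg List.length hζ
      have hη' := List.length_pos_iff.2 hη
      simp only [List.length_append, List.length_singleton] at hlen
      have hζ' : ζ = [] := List.eq_nil_of_length_eq_zero (by omega)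
      rw [← hζ, hζ', List.append_nil]
  · exact absurd (cfDen_le_of_extends hω hp).2 (not_le.2 h)

/-- The mass of a level-`l` union dominates the mass of its letters. -/
lemma IsConformal.exists_cylMass_le {E : Set ℕ} {δ : ℝ} {μ : Measure ℝ} {lam : ℝ}
    (hE : 0 ∉ E) (hδ : 0 ≤ δ) (hμ : IsConformal E δ μ) (hlam : 1 < lam)
    (hC : AssumptionC E μ lam) :
    ∃ K : ℝ≥0∞, K ≠ ⊤ ∧ ∀ J ⊆ E, ∀ l : ℕ, (W lam l ∩ words E).Nonempty →
      cylMass μ J ≤ K * μ (cylUnion E lam l J) := by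
  obtain ⟨K, hK, h⟩ := hμ.exists_one_le_mul_tsum_W hE hδ hlam hC
  refine ⟨K * (ENNReal.ofReal (4 ^ (2 * δ)) * ⌈√lam⌉₊), by finiteness, fun J hJ l hl => ?_⟩
  calc cylMass μ J ≤ K * (∑' τ : ↥(W lam l ∩ words E), μ (cyl (τ : List ℕ))) * cylMass μ J :=
        (one_mul _).symm.le.trans (mul_le_mul_left (h l hl) _)
    _ = K * ∑' τ : ↥(W lam l ∩ words E), ∑' a : J, μ (cyl (τ : List ℕ)) * μ (cyl [(a : ℕ)]) := by
        simp_rw [ENNReal.tsum_mul_left, ENNReal.tsum_mul_right]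
        rw [mul_assoc, cylMass]
    _ ≤ K * ∑' τ : ↥(W lam l ∩ words E), ∑' a : J,
          ENNReal.ofReal (4 ^ (2 * δ)) * μ (cyl ((τ : List ℕ) ++ [(a : ℕ)])) :=
        mul_le_mul_right (ENNReal.tsum_le_tsum fun τ => ENNReal.tsum_le_tsum fun a =>
          (hμ.measure_cyl_append hE hδ τ.2.2 (words_singleton.2 (hJ a.2))).2) _
    _ = K * (ENNReal.ofReal (4 ^ (2 * δ)) * ∑' p : ↥(W lam l ∩ words E) × J,
          μ (cyl ((p.1 : List ℕ) ++ [(p.2 : ℕ)]))) := by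
        simp_rw [ENNReal.tsum_mul_left]
        rw [ENNReal.tsum_prod (f := fun (τ : ↥(W lam l ∩ words E)) (a : J) =>
          μ (cyl ((τ : List ℕ) ++ [(a : ℕ)])))]
    _ ≤ K * (ENNReal.ofReal (4 ^ (2 * δ)) * (⌈√lam⌉₊ * μ (cylUnion E lam l J))) := by
        refine mul_le_mul_right (mul_le_mul_right ?_ _) _
        refine hμ.tsum_cyl_snoc_le hE hδ inter_subset_right hJ (Real.sqrt_nonneg _)
          (M := √lam ^ l) ?_ ?_
        · exact fun τ hτ => ((mem_W_iff hlam (one_le_of_mem_words hE hτ.2)).1 hτ.1).1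
        · exact fun τ hτ => pow_succ' (√lam) l ▸
            ((mem_W_iff hlam (one_le_of_mem_words hE hτ.2)).1 hτ.1).2
    _ = _ := by ring

lemma IsConformal.measure_inter_cylUnion_le {E : Set ℕ} {δ : ℝ} {μ : Measure ℝ} {lam : ℝ}
    (hE : 0 ∉ E) (hδ : 0 ≤ δ) (hμ : IsConformal E δ μ) (hlam : 1 < lam) {J J' : Set ℕ}
    (hJ : J ⊆ E) (hJ' : J' ⊆ E) {k l : ℕ} (hkl : k < l) :
    μ (cylUnion E lam k J ∩ cylUnion E lam l J') ≤
      ENNReal.ofReal (4 ^ (2 * δ)) ^ 2 * (⌈√lam⌉₊ * ⌈2 * √lam⌉₊) *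
        μ (cylUnion E lam k J) * cylMass μ J' := by
  have := hμ.1
  have hs : 1 < √lam := Real.lt_sqrt_of_sq_lt (by simpa using hlam)
  set K : ℝ≥0∞ := ENNReal.ofReal (4 ^ (2 * δ)) with hK
  let P := ↥(W lam k ∩ words E) × J
  let V : P → Set (List ℕ) := fun p =>
    {η | η ∈ words E ∧ √lam ^ l / (2 * cfDen ((p.1 : List ℕ) ++ [(p.2 : ℕ)])) ≤ cfDen η ∧
      cfDen η < 2 * √lam * (√lam ^ l / (2 * cfDen ((p.1 : List ℕ) ++ [(p.2 : ℕ)])))}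
  have hP : ∀ p : P, (p.1 : List ℕ) ++ [(p.2 : ℕ)] ∈ words E := fun p =>
    words_append.2 ⟨p.1.2.2, words_singleton.2 (hJ p.2.2)⟩
  have hcover : μ (cylUnion E lam k J ∩ cylUnion E lam l J') ≤
      μ (⋃ p : P, ⋃ η : V p, ⋃ b : J',
        cyl ((p.1 : List ℕ) ++ [(p.2 : ℕ)] ++ (η : List ℕ) ++ [(b : ℕ)])) := by
    refine measure_mono_ae ?_
    filter_upwards [hμ.ae_irrational hE hδ] with x hx ⟨h1, h2⟩
    simp only [cylUnion, mem_iUnion] at h1 h2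
    obtain ⟨ω, hω, a, ha, hxω⟩ := h1
    obtain ⟨τ, hτ, b, hb, hxτ⟩ := h2
    have pω := one_le_of_mem_words hE hω.2
    have pτ := one_le_of_mem_words hE hτ.2
    have pa := one_le_of_mem_words hE (words_singleton.2 (hJ ha))
    have pb := one_le_of_mem_words hE (words_singleton.2 (hJ' hb))
    have bω := (mem_W_iff hlam pω).1 hω.1
    have bτ := (mem_W_iff hlam pτ).1 hτ.1
    have hlt : cfDen ω < cfDen τ :=
      bω.2.trans_le ((pow_le_pow_right₀ hs.le hkl).trans bτ.1)
    obtain ⟨η, rfl⟩ := prefix_of_mem_cyl pω pτ (pa a (by simp)) hlt hx hxω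
      (cyl_append_subset pb hxτ)
    have hw := words_append.1 hτ.2
    have pωa := one_le_of_mem_words hE hw.1
    have pη := one_le_of_mem_words hE hw.2
    have hden := cfDen_append_bounds pωa pη
    have hq := cfDen_pos pωa
    refine mem_iUnion.2 ⟨(⟨ω, hω⟩, ⟨a, ha⟩), mem_iUnion.2 ⟨⟨η, hw.2, ?_, ?_⟩,
      mem_iUnion.2 ⟨⟨b, hb⟩, hxτ⟩⟩⟩
    · rw [div_le_iff₀ (by positivity)]
      linarith [bτ.1]
    · have := bτ.2
      rw [pow_succ'] at this
      rw [mul_div_assoc', lt_div_iff₀ (by positivity)]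
      linarith
  calc _ ≤ ∑' p : P, ∑' η : V p, ∑' b : J',
        μ (cyl ((p.1 : List ℕ) ++ [(p.2 : ℕ)] ++ (η : List ℕ) ++ [(b : ℕ)])) :=
        hcover.trans <| (measure_iUnion_le _).trans <| ENNReal.tsum_le_tsum fun p =>
          (measure_iUnion_le _).trans <| ENNReal.tsum_le_tsum fun η => measure_iUnion_le _
    _ ≤ ∑' p : P, ∑' η : V p, ∑' b : J', K * (K * (μ (cyl ((p.1 : List ℕ) ++ [(p.2 : ℕ)])) *
          μ (cyl (η : List ℕ))) * μ (cyl [(b : ℕ)])) := by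
        refine ENNReal.tsum_le_tsum fun p => ENNReal.tsum_le_tsum fun η =>
          ENNReal.tsum_le_tsum fun b => ?_
        refine (hμ.measure_cyl_append hE hδ (words_append.2 ⟨hP p, η.2.1⟩)
          (words_singleton.2 (hJ' b.2))).1.trans ?_
        exact mul_le_mul_right (mul_le_mul_left
          (hμ.measure_cyl_append hE hδ (hP p) η.2.1).1 _) _
    _ = ∑' p : P, K * (K * (μ (cyl ((p.1 : List ℕ) ++ [(p.2 : ℕ)])) *
          ∑' η : V p, μ (cyl (η : List ℕ))) * cylMass μ J') := by
        simp_rw [ENNReal.tsum_mul_left, ENNReal.tsum_mul_right, ENNReal.tsum_mul_left, cylMass]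
    _ ≤ ∑' p : P, K * (K * (μ (cyl ((p.1 : List ℕ) ++ [(p.2 : ℕ)])) *
          ⌈2 * √lam⌉₊) * cylMass μ J') := by
        refine ENNReal.tsum_le_tsum fun p => mul_le_mul_right (mul_le_mul_left
          (mul_le_mul_right (mul_le_mul_right ?_ _) _) _) _
        simpa using hμ.tsum_cyl_le hE hδ (V := V p) (fun η hη => hη.1) (by positivity)
          (fun η hη => hη.2.1) (fun η hη => hη.2.2) MeasurableSet.univ
    _ = K ^ 2 * ⌈2 * √lam⌉₊ * cylMass μ J' *
          ∑' p : P, μ (cyl ((p.1 : List ℕ) ++ [(p.2 : ℕ)])) := by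
        rw [← ENNReal.tsum_mul_left]
        exact tsum_congr fun p => by ring
    _ ≤ K ^ 2 * ⌈2 * √lam⌉₊ * cylMass μ J' * (⌈√lam⌉₊ * μ (cylUnion E lam k J)) := by
        refine mul_le_mul_right ?_ _
        refine hμ.tsum_cyl_snoc_le hE hδ inter_subset_right hJ (Real.sqrt_nonneg _)
          (M := √lam ^ k) ?_ ?_
        · exact fun τ hτ => ((mem_W_iff hlam (one_le_of_mem_words hE hτ.2)).1 hτ.1).1
        · exact fun τ hτ => pow_succ' (√lam) k ▸
            ((mem_W_iff hlam (one_le_of_mem_words hE hτ.2)).1 hτ.1).2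
    _ = _ := by ring

/-- quasi-independence. For a regular Gauss IFS satisfying Assumption C with
constant `λ > 1`, and `A_k = ⋃{[ωa] : ω ∈ W_k, a ∈ J_k}`, there is `C > 0` independent of the
`J_k` with `μ(A_k ∩ A_ℓ) ≤ C μ(A_k) μ(A_ℓ)` for `k ≠ ℓ`. -/
theorem stmt8 (E : Set ℕ) (hE : 0 ∉ E) (δ : ℝ) (hδ : 0 ≤ δ) (hpress : pressure E δ = 0)
    (μ : Measure ℝ) (hμ : IsConformal E δ μ)
    (lam : ℝ) (hlam : 1 < lam) (hC : AssumptionC E μ lam) :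
    ∃ C : ℝ≥0∞, C ≠ ⊤ ∧ ∀ (J : ℕ → Set ℕ), (∀ k, J k ⊆ E) → ∀ k l : ℕ, k ≠ l →
      μ (cylUnion E lam k (J k) ∩ cylUnion E lam l (J l)) ≤
        C * μ (cylUnion E lam k (J k)) * μ (cylUnion E lam l (J l)) := by
  obtain ⟨K, hK, h⟩ := hμ.exists_cylMass_le hE hδ hlam hC
  set K' : ℝ≥0∞ := ENNReal.ofReal (4 ^ (2 * δ)) ^ 2 * (⌈√lam⌉₊ * ⌈2 * √lam⌉₊) with hK'
  have key : ∀ J J' : Set ℕ, J ⊆ E → J' ⊆ E → ∀ k l : ℕ, k < l →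
      μ (cylUnion E lam k J ∩ cylUnion E lam l J') ≤
        K' * K * μ (cylUnion E lam k J) * μ (cylUnion E lam l J') := by
    intro J J' hJ hJ' k l hkl
    rcases (W lam l ∩ words E).eq_empty_or_nonempty with hW | hW
    · simp [cylUnion, hW]
    · calc _ ≤ K' * μ (cylUnion E lam k J) * cylMass μ J' :=
            hμ.measure_inter_cylUnion_le hE hδ hlam hJ hJ' hkl
        _ ≤ K' * μ (cylUnion E lam k J) * (K * μ (cylUnion E lam l J')) :=
            mul_le_mul_right (h J' hJ' l hW) _
        _ = _ := by ring
  refine ⟨K' * K, by finiteness, fun J hJ k l hkl => ?_⟩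
  rcases hkl.lt_or_gt with hlt | hlt
  · exact key _ _ (hJ k) (hJ l) k l hlt
  · rw [inter_comm, mul_right_comm]
    exact key _ _ (hJ l) (hJ k) l k hlt
end
end

section
/- Global measure formula for Gauss IFSes: Let Φ_E be a regular Gauss IFS with conformal measure μ. Then there exist constants C ≥ 1 and C' > 0 such that for all x = π(ω) ∈ Λ_E and all r > 0, there exists n ∈ ℕ with [ω|(n+1)] ⊆ B(x, Cr) and M(x,n,r) ≤ μ(B(x,r)) ≤ C'·M(x,n,Cr), where M(x,n,r) = ∑_{a∈E, [(ω|n)a] ⊆ B(x,r)} μ((ω|n)a). -/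
open MeasureTheory Metric Filter Set
open scoped ENNReal Topology NNReal

noncomputable section

/-- The denominator of `wordMap l` viewed as a Möbius map, evaluated at `t`. -/
def wordDen : List ℕ → ℝ → ℝ
  | [] => fun _ => 1
  | a :: l => fun t => (a + wordMap l t) * wordDen l t

/-- All letters of a word are positive. -/
def PosWord (l : List ℕ) : Prop := ∀ a ∈ l, 1 ≤ a

lemma PosWord.head {a : ℕ} {l : List ℕ} (h : PosWord (a :: l)) : (1 : ℝ) ≤ a := by
  exact_mod_cast h a (by simp)

lemma PosWord.tail {a : ℕ} {l : List ℕ} (h : PosWord (a :: l)) : PosWord l :=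
  fun b hb => h b (by simp [hb])

lemma PosWord.append {l m : List ℕ} (hl : PosWord l) (hm : PosWord m) : PosWord (l ++ m) := by
  intro a ha
  rcases List.mem_append.1 ha with h | h
  exacts [hl a h, hm a h]

lemma PosWord.left {l m : List ℕ} (h : PosWord (l ++ m)) : PosWord l :=
  fun a ha => h a (by simp [ha])

lemma posWord_singleton {a : ℕ} (h : 1 ≤ a) : PosWord [a] := by
  simpa [PosWord] using h

lemma gaussMap_mem_Icc {a : ℕ} (ha : 1 ≤ a) {t : ℝ} (ht : t ∈ Icc (0 : ℝ) 1) :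
    gaussMap a t ∈ Icc (0 : ℝ) 1 := by
  have ha' : (1 : ℝ) ≤ a := by exact_mod_cast ha
  have := ht.1
  refine ⟨by unfold gaussMap; positivity, ?_⟩
  unfold gaussMap
  rw [div_le_one (by linarith)]
  linarith

lemma wordMap_mem_Icc {l : List ℕ} (hl : PosWord l) {t : ℝ} (ht : t ∈ Icc (0 : ℝ) 1) :
    wordMap l t ∈ Icc (0 : ℝ) 1 := by
  induction l with
  | nil => exact ht
  | cons a l ih => exact gaussMap_mem_Icc (hl a (by simp)) (ih hl.tail)

lemma wordMap_append_s10 (l m : List ℕ) (t : ℝ) :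
    wordMap (l ++ m) t = wordMap l (wordMap m t) := by
  induction l with
  | nil => rfl
  | cons a l ih => simp only [List.cons_append, wordMap, ih]

lemma wordDen_append (l m : List ℕ) (t : ℝ) :
    wordDen (l ++ m) t = wordDen l (wordMap m t) * wordDen m t := by
  induction l with
  | nil => simp [wordDen]
  | cons a l ih => simp only [List.cons_append, wordDen, ih, wordMap_append_s10, mul_assoc]

lemma wordDen_ge_one {l : List ℕ} (hl : PosWord l) {t : ℝ} (ht : t ∈ Icc (0 : ℝ) 1) :
    1 ≤ wordDen l t := by
  induction l with
  | nil => simp [wordDen]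
  | cons a l ih =>
    have h1 := hl.head
    have h2 := (wordMap_mem_Icc hl.tail ht).1
    exact one_le_mul_of_one_le_of_one_le (by linarith) (ih hl.tail)

lemma wordDen_pos {l : List ℕ} (hl : PosWord l) {t : ℝ} (ht : t ∈ Icc (0 : ℝ) 1) :
    0 < wordDen l t := one_pos.trans_le (wordDen_ge_one hl ht)

lemma length_le_wordDen {l : List ℕ} (hl : PosWord l) {t : ℝ} (ht : t ∈ Icc (0 : ℝ) 1) :
    (l.length : ℝ) ≤ wordDen l t := by
  induction l with
  | nil => simp [wordDen]
  | cons a l ih =>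
    have h1 := hl.head
    have h3 := ih hl.tail
    have h4 := wordDen_ge_one hl.tail ht
    have key : 1 ≤ wordMap l t * wordDen l t ∨ l = [] := by
      cases l with
      | nil => right; rfl
      | cons b m =>
        left
        have hb := hl.tail.head
        have hm := (wordMap_mem_Icc hl.tail.tail ht).1
        have : wordMap (b :: m) t * wordDen (b :: m) t = wordDen m t := by
          simp only [wordMap, wordDen, gaussMap]
          field_simp
        rw [this]
        exact wordDen_ge_one hl.tail.tail ht
    have : wordDen (a :: l) t = (a - 1) * wordDen l t + wordDen l t + wordMap l t * wordDen l t := by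
      simp only [wordDen]; ring
    have h5 : 0 ≤ ((a : ℝ) - 1) * wordDen l t := mul_nonneg (by linarith) (by linarith)
    rcases key with key | rfl
    · push_cast [List.length_cons]; linarith
    · simp [wordDen, wordMap]; linarith [ht.1]

lemma wordDen_distortion {l : List ℕ} (hl : PosWord l) {s t : ℝ} (hs : s ∈ Icc (0 : ℝ) 1)
    (ht : t ∈ Icc (0 : ℝ) 1) : wordDen l s ≤ 2 * wordDen l t := by
  suffices h : wordDen l s ≤ 2 * wordDen l t ∧
      (1 + wordMap l s) * wordDen l s ≤ 2 * ((1 + wordMap l t) * wordDen l t) from h.1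
  induction l with
  | nil => simp only [wordDen, wordMap]; constructor <;> linarith [hs.1, hs.2, ht.1, ht.2]
  | cons a l ih =>
    obtain ⟨h1, h2⟩ := ih hl.tail
    have ha := hl.head
    have hws := (wordMap_mem_Icc hl.tail hs).1
    have hwt := (wordMap_mem_Icc hl.tail ht).1
    have h3 : ((a : ℝ) - 1) * wordDen l s ≤ (a - 1) * (2 * wordDen l t) :=
      mul_le_mul_of_nonneg_left h1 (by linarith)
    have h4 : wordDen (a :: l) s ≤ 2 * wordDen (a :: l) t := by
      simp only [wordDen]; nlinarith
    refine ⟨h4, ?_⟩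
    have e : ∀ u, 0 ≤ wordMap l u →
        (1 + wordMap (a :: l) u) * wordDen (a :: l) u = wordDen (a :: l) u + wordDen l u := by
      intro u hu
      simp only [wordMap, wordDen, gaussMap]
      field_simp
    rw [e s hws, e t hwt]
    linarith

lemma wordMap_sub {l : List ℕ} (hl : PosWord l) {s t : ℝ} (hs : s ∈ Icc (0 : ℝ) 1)
    (ht : t ∈ Icc (0 : ℝ) 1) :
    wordMap l s - wordMap l t = (-1) ^ l.length * ((s - t) / (wordDen l s * wordDen l t)) := by
  induction l with
  | nil => simp [wordMap, wordDen]
  | cons a l ih =>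
    have ha := hl.head
    have hws := (wordMap_mem_Icc hl.tail hs).1
    have hwt := (wordMap_mem_Icc hl.tail ht).1
    have hds := wordDen_pos hl.tail hs
    have hdt := wordDen_pos hl.tail ht
    have e : wordMap (a :: l) s - wordMap (a :: l) t =
        -(wordMap l s - wordMap l t) / ((a + wordMap l s) * (a + wordMap l t)) := by
      simp only [wordMap, gaussMap]
      field_simp
      ring
    rw [e, ih hl.tail]
    simp only [wordDen, List.length_cons, pow_succ]
    field_simp

lemma abs_wordMap_sub_s10 {l : List ℕ} (hl : PosWord l) {s t : ℝ} (hs : s ∈ Icc (0 : ℝ) 1)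
    (ht : t ∈ Icc (0 : ℝ) 1) :
    |wordMap l s - wordMap l t| = |s - t| / (wordDen l s * wordDen l t) := by
  have hds := wordDen_pos hl hs
  have hdt := wordDen_pos hl ht
  rw [wordMap_sub hl hs ht, abs_mul, abs_pow, abs_neg, abs_one, one_pow, one_mul, abs_div,
    abs_of_pos (mul_pos hds hdt)]

lemma zero_mem_unit : (0 : ℝ) ∈ Icc (0 : ℝ) 1 := by simp

lemma one_mem_unit : (1 : ℝ) ∈ Icc (0 : ℝ) 1 := by simp

lemma abs_wordMap_sub_le_s10 {l : List ℕ} (hl : PosWord l) {s t : ℝ} (hs : s ∈ Icc (0 : ℝ) 1)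
    (ht : t ∈ Icc (0 : ℝ) 1) :
    |wordMap l s - wordMap l t| ≤ 4 * |s - t| / wordDen l 0 ^ 2 := by
  have h0 := wordDen_pos hl zero_mem_unit
  have h1 := wordDen_distortion hl zero_mem_unit hs
  have h2 := wordDen_distortion hl zero_mem_unit ht
  have hds := wordDen_pos hl hs
  have hdt := wordDen_pos hl ht
  rw [abs_wordMap_sub_s10 hl hs ht, div_le_div_iff₀ (by positivity) (by positivity)]
  nlinarith [abs_nonneg (s - t), mul_le_mul h1 h2 h0.le (by positivity),
    mul_le_mul_of_nonneg_left (mul_le_mul h1 h2 h0.le (by positivity)) (abs_nonneg (s - t))]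

lemma abs_sub_le_wordMap {l : List ℕ} (hl : PosWord l) {s t : ℝ} (hs : s ∈ Icc (0 : ℝ) 1)
    (ht : t ∈ Icc (0 : ℝ) 1) :
    |s - t| ≤ 4 * wordDen l 0 ^ 2 * |wordMap l s - wordMap l t| := by
  have h0 := wordDen_pos hl zero_mem_unit
  have h1 := wordDen_distortion hl hs zero_mem_unit
  have h2 := wordDen_distortion hl ht zero_mem_unit
  have hds := wordDen_pos hl hs
  have hdt := wordDen_pos hl ht
  rw [abs_wordMap_sub_s10 hl hs ht, ← mul_div_assoc, le_div_iff₀ (by positivity)]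
  nlinarith [mul_le_mul_of_nonneg_left (mul_le_mul h1 h2 hdt.le (by positivity))
    (abs_nonneg (s - t))]

lemma wordMap_injOn {l : List ℕ} (hl : PosWord l) : InjOn (wordMap l) (Icc 0 1) := by
  intro s hs t ht h
  have := abs_sub_le_wordMap hl hs ht
  rw [h, sub_self, abs_zero, mul_zero] at this
  exact sub_eq_zero.1 (abs_nonpos_iff.1 this)

lemma continuousOn_wordMap {l : List ℕ} (hl : PosWord l) :
    ContinuousOn (wordMap l) (Icc 0 1) := by
  induction l with
  | nil => exact continuousOn_id
  | cons a l ih =>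
    have ha := hl.head
    refine ContinuousOn.div continuousOn_const (continuousOn_const.add (ih hl.tail)) ?_
    intro t ht
    linarith [(wordMap_mem_Icc hl.tail ht).1]

lemma isCompact_cyl {l : List ℕ} (hl : PosWord l) : IsCompact (cyl l) :=
  isCompact_Icc.image_of_continuousOn (continuousOn_wordMap hl)

lemma measurableSet_cyl_s10 {l : List ℕ} (hl : PosWord l) : MeasurableSet (cyl l) :=
  (isCompact_cyl hl).measurableSet

lemma ordConnected_cyl {l : List ℕ} (hl : PosWord l) : OrdConnected (cyl l) :=
  (isPreconnected_Icc.image _ (continuousOn_wordMap hl)).ordConnected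

lemma cyl_append (l m : List ℕ) : cyl (l ++ m) = wordMap l '' cyl m := by
  simp only [cyl, image_image, wordMap_append_s10]

lemma cyl_subset_unit {l : List ℕ} (hl : PosWord l) : cyl l ⊆ Icc 0 1 := by
  rintro _ ⟨t, ht, rfl⟩
  exact wordMap_mem_Icc hl ht

lemma cyl_append_subset_s10 (l : List ℕ) {m : List ℕ} (hm : PosWord m) : cyl (l ++ m) ⊆ cyl l := by
  rw [cyl_append]
  exact image_mono (cyl_subset_unit hm)

/-- A point of `[0,1]` close to `wordMap l 0` is in `cyl l` or in the cylinder on the other side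
of that endpoint, whose word has the same denominator at `0`. -/
lemma exists_adjacent {l : List ℕ} (hl : PosWord l) :
    ∃ σ, PosWord σ ∧ wordMap σ 0 = wordMap l 0 ∧ wordDen σ 0 = wordDen l 0 ∧
      ∀ y ∈ Icc (0 : ℝ) 1, 2 * wordDen l 0 ^ 2 * |y - wordMap l 0| ≤ 1 → y ∈ cyl l ∨ y ∈ cyl σ := by
  have main : ∀ l σ : List ℕ, PosWord l → PosWord σ → wordMap σ 0 = wordMap l 0 →
      wordDen σ 0 = wordDen l 0 → (-1 : ℝ) ^ σ.length = -(-1) ^ l.length →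
      ∀ y ∈ Icc (0 : ℝ) 1, 2 * wordDen l 0 ^ 2 * |y - wordMap l 0| ≤ 1 →
        y ∈ cyl l ∨ y ∈ cyl σ := by
    intro l σ hl hσ hw hd hs y _ h
    have side : ∀ m : List ℕ, PosWord m → wordMap m 0 = wordMap l 0 → wordDen m 0 = wordDen l 0 →
        0 ≤ (-1) ^ m.length * (y - wordMap l 0) → y ∈ cyl m := by
      intro m hm hmw hmd hsgn
      have h0 := wordDen_pos hm zero_mem_unit
      have h1 := wordDen_pos hm one_mem_unit
      have hdis := wordDen_distortion hm one_mem_unit zero_mem_unit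
      have e := wordMap_sub hm one_mem_unit zero_mem_unit
      rw [hmw] at e
      rw [sub_zero] at e
      have hge : |y - wordMap l 0| ≤ 1 / (wordDen m 1 * wordDen m 0) := by
        rw [le_div_iff₀ (by positivity)]
        rw [← hmd] at h
        refine le_trans ?_ h
        nlinarith [mul_le_mul_of_nonneg_left
          (mul_le_mul_of_nonneg_right hdis h0.le) (abs_nonneg (y - wordMap l 0))]
      have m0 : wordMap l 0 ∈ cyl m := hmw ▸ mem_image_of_mem _ zero_mem_unit
      have m1 : wordMap m 1 ∈ cyl m := mem_image_of_mem _ one_mem_unit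
      rcases neg_one_pow_eq_or ℝ m.length with hp | hp
      · rw [hp] at hsgn e
        refine (ordConnected_cyl hm).out m0 m1 ⟨by linarith, ?_⟩
        linarith [le_abs_self (y - wordMap l 0)]
      · rw [hp] at hsgn e
        refine (ordConnected_cyl hm).out m1 m0 ⟨?_, by linarith⟩
        linarith [neg_abs_le (y - wordMap l 0)]
    rcases le_total 0 ((-1) ^ l.length * (y - wordMap l 0)) with hc | hc
    · exact Or.inl (side l hl rfl rfl hc)
    · refine Or.inr (side σ hσ hw hd ?_)
      rw [hs]; linarith
  have glue : ∀ τ m m' : List ℕ, l = τ ++ m → PosWord m' → wordMap m' 0 = wordMap m 0 →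
      wordDen m' 0 = wordDen m 0 → (-1 : ℝ) ^ m'.length = -(-1) ^ m.length →
      ∃ σ, PosWord σ ∧ wordMap σ 0 = wordMap l 0 ∧ wordDen σ 0 = wordDen l 0 ∧
      ∀ y ∈ Icc (0 : ℝ) 1, 2 * wordDen l 0 ^ 2 * |y - wordMap l 0| ≤ 1 →
        y ∈ cyl l ∨ y ∈ cyl σ := by
    rintro τ m m' rfl hm' hw hd hs
    have e1 : wordMap (τ ++ m') 0 = wordMap (τ ++ m) 0 := by simp only [wordMap_append_s10, hw]
    have e2 : wordDen (τ ++ m') 0 = wordDen (τ ++ m) 0 := by simp only [wordDen_append, hw, hd]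
    exact ⟨τ ++ m', hl.left.append hm', e1, e2, main _ _ hl (hl.left.append hm') e1 e2
      (by simp only [List.length_append, pow_add, hs]; ring)⟩
  rcases List.eq_nil_or_concat l with rfl | ⟨τ, b, rfl⟩
  · refine ⟨[], hl, rfl, rfl, fun y hy _ => Or.inl ?_⟩
    exact ⟨y, hy, rfl⟩
  have hb : 1 ≤ b := hl b (by simp)
  rcases hb.lt_or_eq with hb | rfl
  · obtain ⟨c, rfl⟩ : ∃ c, b = c + 1 := ⟨b - 1, by omega⟩
    refine glue τ [c + 1] [c, 1] (by simp) ?_ ?_ ?_ ?_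
    · intro a ha; simp at ha; omega
    · simp [wordMap, gaussMap]
    · simp [wordMap, wordDen, gaussMap]
    · simp
  · rcases List.eq_nil_or_concat τ with rfl | ⟨τ', c, rfl⟩
    · refine ⟨[1], by simp [PosWord], by simp, by simp, fun y hy h => Or.inl ?_⟩
      simp only [List.concat_eq_append, List.nil_append, wordDen, wordMap, gaussMap] at h ⊢
      norm_num at h
      rw [abs_of_nonpos (by linarith [hy.2])] at h
      have hy0 : 0 < y := by linarith
      refine ⟨1 / y - 1, ⟨?_, ?_⟩, ?_⟩
      · rw [sub_nonneg, le_div_iff₀ hy0]; linarith [hy.2]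
      · rw [sub_le_iff_le_add, div_le_iff₀ hy0]; linarith
      · simp [wordMap, gaussMap]
    · refine glue τ' [c, 1] [c + 1] (by simp) ?_ ?_ ?_ ?_
      · intro a ha; simp at ha; omega
      · simp [wordMap, gaussMap]
      · simp [wordMap, wordDen, gaussMap]
      · simp

/-- The initial word of length `n` of an infinite word. -/
def initWord (ω : ℕ → ℕ) (n : ℕ) : List ℕ := List.ofFn fun i : Fin n => ω i

/-- The infinite word with the first `k` letters removed. -/
def dropWord (ω : ℕ → ℕ) (k : ℕ) : ℕ → ℕ := fun n => ω (n + k)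

lemma initWord_succ (ω : ℕ → ℕ) (n : ℕ) : initWord ω (n + 1) = initWord ω n ++ [ω n] := by
  simp only [initWord, List.ofFn_succ', List.concat_eq_append, Fin.val_castSucc, Fin.val_last]

lemma initWord_succ_left (ω : ℕ → ℕ) (n : ℕ) :
    initWord ω (n + 1) = ω 0 :: initWord (dropWord ω 1) n := by
  simp [initWord, dropWord, List.ofFn_succ]

lemma length_initWord (ω : ℕ → ℕ) (n : ℕ) : (initWord ω n).length = n := by
  simp [initWord]

lemma initWord_mem {P : ℕ → Prop} {ω : ℕ → ℕ} (hω : ∀ n, P (ω n)) (n : ℕ) :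
    ∀ a ∈ initWord ω n, P a := by
  intro a ha
  simp only [initWord, List.mem_ofFn] at ha
  obtain ⟨i, rfl⟩ := ha
  exact hω _

lemma posWord_initWord {ω : ℕ → ℕ} (hω : ∀ n, 1 ≤ ω n) (n : ℕ) : PosWord (initWord ω n) :=
  initWord_mem hω n

lemma cyl_initWord_antitone {ω : ℕ → ℕ} (hω : ∀ n, 1 ≤ ω n) {n m : ℕ} (h : n ≤ m) :
    cyl (initWord ω m) ⊆ cyl (initWord ω n) := by
  induction m, h using Nat.le_induction with
  | base => exact subset_rfl
  | succ m _ ih =>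
    rw [initWord_succ]
    exact (cyl_append_subset_s10 _ (posWord_singleton (hω m))).trans ih

lemma abs_sub_le_of_mem_cyl {l : List ℕ} (hl : PosWord l) {x y : ℝ} (hx : x ∈ cyl l)
    (hy : y ∈ cyl l) : |x - y| ≤ 2 * (1 / ((l.length : ℝ) + 1)) := by
  obtain ⟨s, hs, rfl⟩ := hx
  obtain ⟨t, ht, rfl⟩ := hy
  have h0 := length_le_wordDen hl hs
  have h1 := wordDen_ge_one hl hs
  have h2 := wordDen_ge_one hl ht
  rw [abs_wordMap_sub_s10 hl hs ht, mul_one_div]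
  have : |s - t| ≤ 1 := abs_le.2 ⟨by linarith [hs.1, ht.2], by linarith [hs.2, ht.1]⟩
  rw [div_le_div_iff₀ (by positivity) (by positivity)]
  nlinarith [abs_nonneg (s - t)]

lemma tendsto_codingMap {ω : ℕ → ℕ} (hω : ∀ n, 1 ≤ ω n) :
    Tendsto (fun n => wordMap (initWord ω n) 0) atTop (𝓝 (codingMap ω)) := by
  refine CauchySeq.tendsto_limUnder ?_
  refine cauchySeq_of_le_tendsto_0' (fun n : ℕ => 2 * (1 / ((n : ℝ) + 1))) ?_ ?_
  · intro n m h
    have := abs_sub_le_of_mem_cyl (posWord_initWord hω n)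
      (mem_image_of_mem _ zero_mem_unit)
      (cyl_initWord_antitone hω h (mem_image_of_mem _ zero_mem_unit))
    rwa [length_initWord] at this
  · simpa using (tendsto_one_div_add_atTop_nhds_zero_nat (𝕜 := ℝ)).const_mul 2

lemma codingMap_mem_cyl {ω : ℕ → ℕ} (hω : ∀ n, 1 ≤ ω n) (n : ℕ) :
    codingMap ω ∈ cyl (initWord ω n) := by
  refine (isCompact_cyl (posWord_initWord hω n)).isClosed.mem_of_tendsto (tendsto_codingMap hω) ?_
  filter_upwards [eventually_ge_atTop n] with m hm
  exact cyl_initWord_antitone hω hm (mem_image_of_mem _ zero_mem_unit)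

lemma codingMap_eq_gaussMap {ω : ℕ → ℕ} (hω : ∀ n, 1 ≤ ω n) :
    codingMap ω = gaussMap (ω 0) (codingMap (dropWord ω 1)) := by
  have h1 : Tendsto (fun n => wordMap (initWord ω (n + 1)) 0) atTop (𝓝 (codingMap ω)) :=
    (tendsto_codingMap hω).comp (tendsto_add_atTop_nat 1)
  have hd : ∀ n, 1 ≤ dropWord ω 1 n := fun n => hω _
  have h2 := tendsto_codingMap hd
  refine tendsto_nhds_unique h1 ?_
  simp only [initWord_succ_left, wordMap]
  have h3 := (codingMap_mem_Icc hd).1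
  have h4 : (1 : ℝ) ≤ ω 0 := by exact_mod_cast hω 0
  exact tendsto_const_nhds.div (tendsto_const_nhds.add h2) (by linarith)

lemma codingMap_mem_Ioo {ω : ℕ → ℕ} (hω : ∀ n, 1 ≤ ω n) : codingMap ω ∈ Ioo (0 : ℝ) 1 := by
  have hpos : ∀ η : ℕ → ℕ, (∀ n, 1 ≤ η n) → 0 < codingMap η := by
    intro η hη
    have h3 := (codingMap_mem_Icc (ω := dropWord η 1) fun n => hη _).1
    have h4 : (1 : ℝ) ≤ η 0 := by exact_mod_cast hη 0
    rw [codingMap_eq_gaussMap hη]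
    unfold gaussMap
    positivity
  refine ⟨hpos ω hω, ?_⟩
  have h3 := hpos (dropWord ω 1) fun n => hω _
  have h4 : (1 : ℝ) ≤ ω 0 := by exact_mod_cast hω 0
  rw [codingMap_eq_gaussMap hω]
  unfold gaussMap
  rw [div_lt_one (by linarith)]
  linarith

lemma eq_of_gaussMap_eq {a b : ℕ} (ha : 1 ≤ a) (hb : 1 ≤ b) {s t : ℝ} (hs : s ∈ Ioo (0 : ℝ) 1)
    (ht : t ∈ Icc (0 : ℝ) 1) (h : gaussMap a s = gaussMap b t) : a = b ∧ s = t := by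
  have ha' : (1 : ℝ) ≤ a := by exact_mod_cast ha
  have hb' : (1 : ℝ) ≤ b := by exact_mod_cast hb
  have h1 : (a : ℝ) + s = b + t := by
    unfold gaussMap at h
    rw [one_div, one_div] at h
    exact inv_injective h
  have h2 : (a : ℝ) < b + 1 := by linarith [hs.1, ht.2]
  have h3 : (b : ℝ) < a + 1 := by linarith [hs.2, ht.1]
  have h4 : a < b + 1 := by exact_mod_cast h2
  have h5 : b < a + 1 := by exact_mod_cast h3
  obtain rfl : a = b := by omega
  exact ⟨rfl, by linarith⟩

/-- A point of the limit set determines every cylinder containing it. -/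
lemma eq_initWord_of_wordMap_eq {ω : ℕ → ℕ} (hω : ∀ n, 1 ≤ ω n) {l : List ℕ} (hl : PosWord l)
    {t : ℝ} (ht : t ∈ Icc (0 : ℝ) 1) (h : codingMap ω = wordMap l t) :
    l = initWord ω l.length ∧ t = codingMap (dropWord ω l.length) := by
  induction l generalizing ω with
  | nil => exact ⟨by simp [initWord], h.symm⟩
  | cons a l ih =>
    have hd : ∀ n, 1 ≤ dropWord ω 1 n := fun n => hω _
    rw [codingMap_eq_gaussMap hω] at h
    obtain ⟨h1, h2⟩ := eq_of_gaussMap_eq (hω 0) (hl a (by simp)) (codingMap_mem_Ioo hd)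
      (wordMap_mem_Icc hl.tail ht) h
    obtain ⟨h3, h4⟩ := ih hd hl.tail h2
    refine ⟨?_, ?_⟩
    · rw [List.length_cons, initWord_succ_left, ← h3, h1]
    · rw [h4]
      congr 1

lemma eq_initWord_of_mem_cyl {ω : ℕ → ℕ} (hω : ∀ n, 1 ≤ ω n) {l : List ℕ} (hl : PosWord l)
    (h : codingMap ω ∈ cyl l) : l = initWord ω l.length := by
  obtain ⟨t, ht, h⟩ := h
  exact (eq_initWord_of_wordMap_eq hω hl ht h.symm).1

lemma codingMap_mem_cyl_append {ω : ℕ → ℕ} (hω : ∀ n, 1 ≤ ω n) {l : List ℕ} (hl : PosWord l)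
    (h : codingMap ω ∈ cyl l) : codingMap ω ∈ cyl (l ++ [ω l.length]) := by
  have := codingMap_mem_cyl hω (l.length + 1)
  rwa [initWord_succ, ← eq_initWord_of_mem_cyl hω hl h] at this

lemma mem_words_of_mem_cyl {E : Set ℕ} (hE : 0 ∉ E) {l : List ℕ} (hl : PosWord l) {x : ℝ}
    (hx : x ∈ limitSet E) (h : x ∈ cyl l) :
    l ∈ words E ∧ ∃ a ∈ E, x ∈ cyl (l ++ [a]) := by
  obtain ⟨ω, hω, rfl⟩ := hx
  have hp : ∀ n, 1 ≤ ω n := fun n => Nat.one_le_iff_ne_zero.2 fun h0 => hE (h0 ▸ hω n)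
  refine ⟨?_, ω l.length, hω _, codingMap_mem_cyl_append hp hl h⟩
  rw [eq_initWord_of_mem_cyl hp hl h]
  exact initWord_mem hω _

lemma posWord_of_mem_words {E : Set ℕ} (hE : 0 ∉ E) {l : List ℕ} (hl : l ∈ words E) :
    PosWord l := fun a ha => Nat.one_le_iff_ne_zero.2 fun h0 => hE (h0 ▸ hl a ha)

lemma limitSet_subset {E : Set ℕ} (hE : 0 ∉ E) : limitSet E ⊆ Ioo 0 1 := by
  rintro _ ⟨ω, hω, rfl⟩
  exact codingMap_mem_Ioo fun n => Nat.one_le_iff_ne_zero.2 fun h0 => hE (h0 ▸ hω n)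

lemma eq_of_mem_cyl_append {E : Set ℕ} (hE : 0 ∉ E) {l : List ℕ} {a b : ℕ}
    (ha : PosWord (l ++ [a])) (hb : PosWord (l ++ [b])) {x : ℝ} (hx : x ∈ limitSet E)
    (hxa : x ∈ cyl (l ++ [a])) (hxb : x ∈ cyl (l ++ [b])) : a = b := by
  obtain ⟨ω, hω, rfl⟩ := hx
  have hp : ∀ n, 1 ≤ ω n := fun n => Nat.one_le_iff_ne_zero.2 fun h0 => hE (h0 ▸ hω n)
  have h1 := eq_initWord_of_mem_cyl hp ha hxa
  have h2 := eq_initWord_of_mem_cyl hp hb hxb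
  simp only [List.length_append, List.length_singleton] at h1 h2
  have := h1.trans h2.symm
  simpa using this

/-- The `δ`-th power of the derivative of `φ_l` on the unit interval. -/
def wordWeight (δ : ℝ) (l : List ℕ) (x : ℝ) : ℝ≥0∞ :=
  ENNReal.ofReal ((wordDen l x ^ 2)⁻¹ ^ δ)

lemma measurable_wordMap (l : List ℕ) : Measurable (wordMap l) := by
  induction l with
  | nil => exact measurable_id
  | cons a l ih => exact (measurable_gaussMap a).comp ih

lemma measurable_wordDen (l : List ℕ) : Measurable (wordDen l) := by
  induction l with
  | nil => exact measurable_const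
  | cons a l ih => exact ((measurable_wordMap l).const_add _).mul ih

lemma measurable_wordWeight (δ : ℝ) (l : List ℕ) : Measurable (wordWeight δ l) := by
  have := measurable_wordDen l
  unfold wordWeight
  fun_prop

lemma wordWeight_cons (δ : ℝ) (a : ℕ) (l : List ℕ) {x : ℝ} :
    wordWeight δ (a :: l) x = wordWeight δ [a] (wordMap l x) * wordWeight δ l x := by
  simp only [wordWeight, wordDen, wordMap, mul_one]
  rw [← ENNReal.ofReal_mul (by positivity), ← Real.mul_rpow (by positivity) (by positivity),
    mul_pow, mul_inv]

lemma wordWeight_le {δ : ℝ} (hδ : 0 ≤ δ) {l m : List ℕ} {x c : ℝ} (hm : 0 < wordDen m x) (hc : 0 < c)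
    (h : wordDen m x ≤ c * wordDen l x) :
    wordWeight δ l x ≤ ENNReal.ofReal ((c ^ 2) ^ δ) * wordWeight δ m x := by
  unfold wordWeight
  rw [← ENNReal.ofReal_mul (by positivity), ← Real.mul_rpow (by positivity) (by positivity)]
  refine ENNReal.ofReal_le_ofReal (Real.rpow_le_rpow (by positivity) ?_ hδ)
  have hl : 0 < wordDen l x := by
    by_contra! hneg
    nlinarith
  rw [← div_eq_mul_inv, le_div_iff₀ (by positivity), inv_mul_le_iff₀ (by positivity), ← mul_pow,
    mul_comm]
  exact pow_le_pow_left₀ hm.le h 2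

lemma abs_deriv_gaussMap {a : ℕ} (ha : 1 ≤ a) {x : ℝ} (hx : 0 ≤ x) :
    |deriv (gaussMap a) x| = (wordDen [a] x ^ 2)⁻¹ := by
  have ha' : (1 : ℝ) ≤ a := by exact_mod_cast ha
  have hne : (a : ℝ) + x ≠ 0 := by linarith
  have h : HasDerivAt (gaussMap a) (-1 / ((a : ℝ) + x) ^ 2) x := by
    have h1 := ((hasDerivAt_id x).const_add (a : ℝ)).inv hne
    have h2 : gaussMap a = fun y => ((a : ℝ) + y)⁻¹ := by
      ext y
      simp [gaussMap]
    rw [h2]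
    exact h1
  rw [h.deriv, abs_div, abs_neg, abs_one, abs_of_nonneg (by positivity), one_div]
  simp [wordDen, wordMap]

section Conformal

variable {E : Set ℕ} {δ : ℝ} {μ : Measure ℝ}

lemma IsConformal.ae_mem (hμ : IsConformal E δ μ) : ∀ᵐ x ∂μ, x ∈ limitSet E := hμ.2.1

lemma IsConformal.measure_inter_cyl (hμ : IsConformal E δ μ) (hE : 0 ∉ E) (hδ : 0 ≤ δ) {a : ℕ}
    (ha : a ∈ E) {B : Set ℝ} (hB : MeasurableSet B) :
    μ (B ∩ cyl [a]) = ∫⁻ x in Icc 0 1 ∩ wordMap [a] ⁻¹' B, wordWeight δ [a] x ∂μ := by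
  have := hμ.1
  have hpos : ∀ b ∈ E, 1 ≤ b := fun b hb => Nat.one_le_iff_ne_zero.2 fun h0 => hE (h0 ▸ hb)
  have hP := posWord_singleton (hpos a ha)
  have hcyl : ∀ (b : E) (x : ℝ), x ∈ limitSet E → gaussMap b x ∈ cyl [a] → (b : ℕ) = a := by
    rintro b x hx ⟨y, hy, hxy⟩
    exact (eq_of_gaussMap_eq (hpos b b.2) (hpos a ha) (limitSet_subset hE hx) hy hxy.symm).1
  have hS : MeasurableSet (Icc (0 : ℝ) 1 ∩ wordMap [a] ⁻¹' B) :=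
    measurableSet_Icc.inter (measurable_wordMap _ hB)
  rw [hμ.2.2 _ (inter_subset_right.trans (cyl_subset_unit hP)) (hB.inter (measurableSet_cyl_s10 hP)),
    tsum_eq_single ⟨a, ha⟩]
  · have hset : (gaussMap a ⁻¹' (B ∩ cyl [a]) : Set ℝ) =ᵐ[μ] (Icc 0 1 ∩ wordMap [a] ⁻¹' B : Set ℝ) := by
      filter_upwards [hμ.ae_mem] with x hx
      have hx' := limitSet_subset hE hx
      apply propext
      constructor
      · rintro ⟨h1, -⟩
        exact ⟨Ioo_subset_Icc_self hx', h1⟩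
      · rintro ⟨h1, h2⟩
        exact ⟨h2, x, h1, rfl⟩
    simp only
    rw [setIntegral_congr_set hset, setIntegral_congr_fun
      (g := fun x => (wordDen [a] x ^ 2)⁻¹ ^ δ) hS
      (fun x hx => by simp only [abs_deriv_gaussMap (hpos a ha) hx.1.1])]
    rw [ofReal_integral_eq_lintegral_ofReal]
    · rfl
    · refine Measure.integrableOn_of_bounded (M := 1) (measure_ne_top _ _) ?_ ?_
      · have := measurable_wordDen [a]
        exact Measurable.aestronglyMeasurable (by fun_prop)
      · refine (ae_restrict_mem hS).mono fun x hx => ?_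
        rw [Real.norm_of_nonneg (by positivity)]
        refine Real.rpow_le_one (by positivity) ?_ hδ
        exact inv_le_one_of_one_le₀ (one_le_pow₀ (wordDen_ge_one hP hx.1))
    · exact ae_of_all _ fun x => by positivity
  · rintro b hb
    have : μ (gaussMap b ⁻¹' (B ∩ cyl [a])) = 0 := by
      have hsub : gaussMap b ⁻¹' (B ∩ cyl [a]) ⊆ (limitSet E)ᶜ := by
        intro x hx hxl
        exact hb (Subtype.ext (hcyl b x hxl hx.2))
      exact measure_mono_null hsub hμ.2.1
    rw [setIntegral_measure_zero _ this, ENNReal.ofReal_zero]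

lemma IsConformal.setLIntegral_cyl_singleton (hμ : IsConformal E δ μ) (hE : 0 ∉ E) (hδ : 0 ≤ δ)
    {a : ℕ} (ha : a ∈ E) {f : ℝ → ℝ≥0∞} (hf : Measurable f) :
    ∫⁻ x in cyl [a], f x ∂μ = ∫⁻ x in Icc 0 1, f (wordMap [a] x) * wordWeight δ [a] x ∂μ := by
  have hm : μ.restrict (cyl [a]) =
      ((μ.restrict (Icc 0 1)).withDensity (wordWeight δ [a])).map (wordMap [a]) := by
    ext B hB
    rw [Measure.restrict_apply hB, hμ.measure_inter_cyl hE hδ ha hB,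
      Measure.map_apply (measurable_wordMap _) hB,
      withDensity_apply _ (measurable_wordMap _ hB),
      Measure.restrict_restrict (measurable_wordMap _ hB), inter_comm]
  have hg : Measurable fun x => f (wordMap [a] x) := hf.comp (measurable_wordMap _)
  rw [hm, lintegral_map hf (measurable_wordMap _),
    lintegral_withDensity_eq_lintegral_mul _ (measurable_wordWeight _ _) hg]
  simp only [Pi.mul_apply, mul_comm]

lemma IsConformal.setLIntegral_cyl (hμ : IsConformal E δ μ) (hE : 0 ∉ E) (hδ : 0 ≤ δ)
    {l : List ℕ} (hl : l ∈ words E) {f : ℝ → ℝ≥0∞} (hf : Measurable f) :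
    ∫⁻ x in cyl l, f x ∂μ = ∫⁻ x in Icc 0 1, f (wordMap l x) * wordWeight δ l x ∂μ := by
  induction l generalizing f with
  | nil => simp [cyl, wordMap, wordWeight, wordDen]
  | cons a l ih =>
    have ha : a ∈ E := hl a (by simp)
    have hl' : l ∈ words E := fun b hb => hl b (by simp [hb])
    have hP := posWord_of_mem_words hE hl
    have hPa : PosWord [a] := posWord_singleton (hP a (by simp))
    have hc : MeasurableSet (cyl (a :: l)) := measurableSet_cyl_s10 hP
    have hsub : cyl (a :: l) ⊆ cyl [a] := cyl_append_subset_s10 [a] hP.tail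
    have hcl := measurableSet_cyl_s10 hP.tail
    have hmem : ∀ x ∈ Icc (0 : ℝ) 1, (wordMap [a] x ∈ cyl (a :: l) ↔ x ∈ cyl l) := by
      intro x hx
      rw [show a :: l = [a] ++ l from rfl, cyl_append]
      exact (wordMap_injOn hPa).mem_image_iff (cyl_subset_unit hP.tail) hx
    calc ∫⁻ x in cyl (a :: l), f x ∂μ
        = ∫⁻ x in cyl [a], (cyl (a :: l)).indicator f x ∂μ := by
          rw [setLIntegral_indicator hc, inter_eq_left.2 hsub]
      _ = ∫⁻ x in Icc 0 1, (cyl (a :: l)).indicator f (wordMap [a] x) * wordWeight δ [a] x ∂μ :=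
          hμ.setLIntegral_cyl_singleton hE hδ ha (hf.indicator hc)
      _ = ∫⁻ x in Icc 0 1, (cyl l).indicator
            (fun x => f (wordMap [a] x) * wordWeight δ [a] x) x ∂μ := by
          refine setLIntegral_congr_fun measurableSet_Icc fun x hx => ?_
          by_cases h : x ∈ cyl l
          · simp only [indicator_of_mem h, indicator_of_mem ((hmem x hx).2 h)]
          · simp only [indicator_of_notMem h, indicator_of_notMem (mt (hmem x hx).1 h), zero_mul]
      _ = ∫⁻ x in cyl l, f (wordMap [a] x) * wordWeight δ [a] x ∂μ := by
          rw [setLIntegral_indicator hcl, inter_eq_left.2 (cyl_subset_unit hP.tail)]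
      _ = _ := by
          have hg : Measurable fun x => f (wordMap [a] x) * wordWeight δ [a] x :=
            (hf.comp (measurable_wordMap _)).mul (measurable_wordWeight _ _)
          rw [ih hl' hg]
          simp only [wordWeight_cons δ a l, mul_assoc]
          rfl

lemma IsConformal.measure_cyl_append_s10 (hμ : IsConformal E δ μ) (hE : 0 ∉ E) (hδ : 0 ≤ δ)
    {l m : List ℕ} (hl : l ∈ words E) (hm : PosWord m) :
    μ (cyl (l ++ m)) = ∫⁻ x in cyl m, wordWeight δ l x ∂μ := by
  have hP := posWord_of_mem_words hE hl
  have hc : MeasurableSet (cyl (l ++ m)) := measurableSet_cyl_s10 (hP.append hm)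
  have h := hμ.setLIntegral_cyl hE hδ hl (measurable_one.indicator hc)
  rw [setLIntegral_indicator hc, inter_eq_left.2 (cyl_append_subset_s10 l hm)] at h
  simp only [Pi.one_apply, setLIntegral_one] at h
  rw [h, ← inter_eq_left.2 (cyl_subset_unit hm), ← setLIntegral_indicator (measurableSet_cyl_s10 hm)]
  refine setLIntegral_congr_fun measurableSet_Icc fun x hx => ?_
  have hmem : wordMap l x ∈ cyl (l ++ m) ↔ x ∈ cyl m := by
    rw [cyl_append]
    exact (wordMap_injOn hP).mem_image_iff (cyl_subset_unit hm) hx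
  by_cases h : x ∈ cyl m
  · simp [indicator_of_mem h, indicator_of_mem (hmem.2 h)]
  · simp [indicator_of_notMem h, indicator_of_notMem (mt hmem.1 h)]

/-- Cylinders with comparable denominators have comparable measures. -/
lemma IsConformal.measure_cyl_append_le (hμ : IsConformal E δ μ) (hE : 0 ∉ E) (hδ : 0 ≤ δ)
    {l σ m : List ℕ} (hl : l ∈ words E) (hσ : σ ∈ words E) (hm : PosWord m)
    (h : wordDen l 0 = wordDen σ 0) :
    μ (cyl (σ ++ m)) ≤ ENNReal.ofReal (((4 : ℝ) ^ 2) ^ δ) * μ (cyl (l ++ m)) := by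
  have hlP := posWord_of_mem_words hE hl
  have hσP := posWord_of_mem_words hE hσ
  rw [hμ.measure_cyl_append_s10 hE hδ hσ hm, hμ.measure_cyl_append_s10 hE hδ hl hm,
    ← lintegral_const_mul _ (measurable_wordWeight _ _)]
  refine setLIntegral_mono ((measurable_wordWeight _ _).const_mul _) fun x hx => ?_
  have hx' := cyl_subset_unit hm hx
  refine wordWeight_le hδ (wordDen_pos hlP hx') (by norm_num) ?_
  linarith [wordDen_distortion hlP hx' zero_mem_unit, wordDen_distortion hσP zero_mem_unit hx']

end Conformal

lemma mem_cyl_singleton {a : ℕ} (ha : 1 ≤ a) {t : ℝ} (ht : t ∈ cyl [a]) :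
    1 / ((a : ℝ) + 1) ≤ t ∧ t ≤ 1 / a := by
  obtain ⟨u, hu, rfl⟩ := ht
  have ha' : (1 : ℝ) ≤ a := by exact_mod_cast ha
  simp only [wordMap, gaussMap]
  exact ⟨one_div_le_one_div_of_le (by linarith [hu.1]) (by linarith [hu.2]),
    one_div_le_one_div_of_le (by linarith) (by linarith [hu.1])⟩

lemma one_div_le_two_mul_of_mem_cyl {a : ℕ} (ha : 1 ≤ a) {t : ℝ} (ht : t ∈ cyl [a]) :
    1 / (a : ℝ) ≤ 2 * t := by
  have ha' : (1 : ℝ) ≤ a := by exact_mod_cast ha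
  refine le_trans ?_ (mul_le_mul_of_nonneg_left (mem_cyl_singleton ha ht).1 zero_le_two)
  rw [mul_one_div, div_le_div_iff₀ (by linarith) (by linarith)]
  linarith

lemma cyl_append_singleton_subset_closedBall {l : List ℕ} (hl : PosWord l) {a b : ℕ} (ha : 1 ≤ a)
    (hb : 1 ≤ b) {x y r : ℝ} (hx : x ∈ cyl (l ++ [a])) (hy : y ∈ cyl (l ++ [b]))
    (hxy : |x - y| ≤ r) (hr : 0 < r) (h1 : 32 * r * wordDen l 0 ^ 2 < 1)
    (h2 : 1 ≤ 32 * r * wordDen (l ++ [a]) 0 ^ 2) :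
    cyl (l ++ [b]) ⊆ closedBall x (4113 * r) := by
  rw [cyl_append] at hx hy ⊢
  obtain ⟨s, hs, rfl⟩ := hx
  obtain ⟨t, ht, rfl⟩ := hy
  rintro _ ⟨u, hu, rfl⟩
  have ha' : (1 : ℝ) ≤ a := by exact_mod_cast ha
  have hb' : (1 : ℝ) ≤ b := by exact_mod_cast hb
  have hs' := cyl_subset_unit (posWord_singleton ha) hs
  have ht' := cyl_subset_unit (posWord_singleton hb) ht
  have hu' := cyl_subset_unit (posWord_singleton hb) hu
  set q := wordDen l 0 with hq
  have hq1 : 1 ≤ q := wordDen_ge_one hl zero_mem_unit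
  set ρ := r * q ^ 2 with hρ
  have hρ0 : 0 < ρ := by positivity
  have hρ1 : 32 * ρ < 1 := by rw [hρ]; linarith
  have hA : (1 / (a : ℝ)) ^ 2 ≤ 128 * ρ := by
    have ha0 : wordMap [a] 0 ∈ Icc (0 : ℝ) 1 :=
      wordMap_mem_Icc (posWord_singleton ha) zero_mem_unit
    have hd := wordDen_distortion hl ha0 zero_mem_unit
    have hd0 := wordDen_pos hl ha0
    have e : wordDen (l ++ [a]) 0 = wordDen l (wordMap [a] 0) * a := by
      rw [wordDen_append]; simp [wordDen, wordMap]
    have h3 : wordDen (l ++ [a]) 0 ^ 2 ≤ (2 * q * a) ^ 2 := by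
      rw [e]
      exact pow_le_pow_left₀ (by positivity) (mul_le_mul_of_nonneg_right hd (by linarith)) 2
    have h4 : 1 ≤ 32 * r * (2 * q * a) ^ 2 :=
      h2.trans (mul_le_mul_of_nonneg_left h3 (by positivity))
    rw [div_pow, one_pow, div_le_iff₀ (by positivity)]
    calc (1 : ℝ) ≤ _ := h4
      _ = _ := by rw [hρ]; ring
  have hst : |s - t| ≤ 4 * ρ := by
    refine (abs_sub_le_wordMap hl hs' ht').trans ?_
    rw [hρ]
    nlinarith [mul_le_mul_of_nonneg_left hxy (sq_nonneg q)]
  have hsa := (mem_cyl_singleton ha hs).2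
  have htb := mem_cyl_singleton hb ht
  have hub := mem_cyl_singleton hb hu
  have h2t := one_div_le_two_mul_of_mem_cyl hb ht
  have ht2 : t ^ 2 ≤ 257 * ρ := by
    have e1 : t ≤ 1 / a + 4 * ρ := by linarith [neg_abs_le (s - t)]
    have e2 : t ^ 2 ≤ (1 / a + 4 * ρ) ^ 2 := pow_le_pow_left₀ ht'.1 e1 2
    nlinarith [sq_nonneg (1 / (a : ℝ) - 4 * ρ)]
  have hB : (1 / (b : ℝ)) ^ 2 ≤ 1028 * ρ := by
    have : (1 / (b : ℝ)) ^ 2 ≤ (2 * t) ^ 2 := pow_le_pow_left₀ (by positivity) h2t 2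
    linarith [this, ht2, mul_pow 2 t 2]
  have hut : |u - t| ≤ (1 / (b : ℝ)) ^ 2 := by
    have e : 1 / (b : ℝ) - 1 / (b + 1) ≤ (1 / (b : ℝ)) ^ 2 := by
      rw [div_sub_div _ _ (by positivity) (by positivity), div_pow,
        div_le_div_iff₀ (by positivity) (by positivity)]
      nlinarith
    rw [abs_le]
    constructor <;> linarith
  have hz : |wordMap l u - wordMap l t| ≤ 4112 * r := by
    refine (abs_wordMap_sub_le_s10 hl hu' ht').trans ?_
    rw [div_le_iff₀ (by positivity)]
    have : |u - t| ≤ 1028 * ρ := hut.trans hB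
    rw [hρ] at this
    linarith
  rw [mem_closedBall, Real.dist_eq]
  calc |wordMap l u - wordMap l s|
      ≤ |wordMap l u - wordMap l t| + |wordMap l t - wordMap l s| := abs_sub_le _ _ _
    _ ≤ 4113 * r := by rw [abs_sub_comm (wordMap l t)]; linarith

lemma cyl_append_singleton_subset_of_adjacent {l σ : List ℕ} (hl : PosWord l) (hσ : PosWord σ)
    (hw : wordMap σ 0 = wordMap l 0) (hd : wordDen σ 0 = wordDen l 0) {b : ℕ} (hb : 1 ≤ b)
    {x y r : ℝ} (hx : |x - wordMap l 0| ≤ r) (hy : |y - wordMap l 0| ≤ r)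
    (hyb : y ∈ cyl (σ ++ [b])) : cyl (l ++ [b]) ⊆ closedBall x (33 * r) := by
  rw [cyl_append] at hyb ⊢
  obtain ⟨t, ht, rfl⟩ := hyb
  rintro _ ⟨u, hu, rfl⟩
  have ht' := cyl_subset_unit (posWord_singleton hb) ht
  have hu' := cyl_subset_unit (posWord_singleton hb) hu
  have hq1 : 1 ≤ wordDen l 0 := wordDen_ge_one hl zero_mem_unit
  have h1 := abs_sub_le_wordMap hσ ht' zero_mem_unit
  rw [hw, hd, sub_zero, abs_of_nonneg ht'.1] at h1
  have h2 := one_div_le_two_mul_of_mem_cyl hb ht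
  have h3 := (mem_cyl_singleton hb hu).2
  have h4 : u ≤ 8 * wordDen l 0 ^ 2 * r := by
    nlinarith [mul_le_mul_of_nonneg_left hy (sq_nonneg (wordDen l 0))]
  have h5 : |wordMap l u - wordMap l 0| ≤ 32 * r := by
    refine (abs_wordMap_sub_le_s10 hl hu' zero_mem_unit).trans ?_
    rw [sub_zero, abs_of_nonneg hu'.1, div_le_iff₀ (by positivity)]
    linarith
  rw [mem_closedBall, Real.dist_eq]
  calc |wordMap l u - x|
      ≤ |wordMap l u - wordMap l 0| + |wordMap l 0 - x| := abs_sub_le _ _ _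
    _ ≤ 33 * r := by rw [abs_sub_comm _ x]; linarith

/-- A segment leaving a cylinder passes through one of its endpoints. -/
lemma near_endpoint_of_notMem_cyl {l : List ℕ} (hl : PosWord l) {x y r : ℝ} (hx : x ∈ cyl l)
    (hy : y ∉ cyl l) (hxy : |x - y| ≤ r) :
    (|x - wordMap l 0| ≤ r ∧ |y - wordMap l 0| ≤ r) ∨
      (|x - wordMap l 1| ≤ r ∧ |y - wordMap l 1| ≤ r) := by
  have m0 : wordMap l 0 ∈ cyl l := mem_image_of_mem _ zero_mem_unit
  have m1 : wordMap l 1 ∈ cyl l := mem_image_of_mem _ one_mem_unit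
  have key : ∀ p, p ∈ uIcc x y → |x - p| ≤ r ∧ |y - p| ≤ r := by
    intro p hp
    exact ⟨(abs_sub_comm x p ▸ abs_sub_left_of_mem_uIcc hp).trans (by rwa [abs_sub_comm]),
      (abs_sub_right_of_mem_uIcc hp).trans (by rwa [abs_sub_comm])⟩
  obtain ⟨s, hs, rfl⟩ := hx
  have hd0 := wordDen_pos hl zero_mem_unit
  have hd1 := wordDen_pos hl one_mem_unit
  have hds := wordDen_pos hl hs
  have e0 := wordMap_sub hl hs zero_mem_unit
  have e1 := wordMap_sub hl one_mem_unit hs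
  have g0 : 0 ≤ (s - 0) / (wordDen l s * wordDen l 0) :=
    div_nonneg (by linarith [hs.1]) (by positivity)
  have g1 : 0 ≤ (1 - s) / (wordDen l 1 * wordDen l s) :=
    div_nonneg (by linarith [hs.2]) (by positivity)
  have hO := ordConnected_cyl hl
  rcases neg_one_pow_eq_or ℝ l.length with hp | hp <;> rw [hp] at e0 e1 <;>
    rcases le_total (wordMap l s) y with hc | hc
  · right
    refine key _ (mem_uIcc.2 (Or.inl ⟨by linarith, ?_⟩))
    by_contra! hlt
    exact hy (hO.out ⟨s, hs, rfl⟩ m1 ⟨hc, hlt.le⟩)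
  · left
    refine key _ (mem_uIcc.2 (Or.inr ⟨?_, by linarith⟩))
    by_contra! hlt
    exact hy (hO.out m0 ⟨s, hs, rfl⟩ ⟨hlt.le, hc⟩)
  · left
    refine key _ (mem_uIcc.2 (Or.inl ⟨by linarith, ?_⟩))
    by_contra! hlt
    exact hy (hO.out ⟨s, hs, rfl⟩ m0 ⟨hc, hlt.le⟩)
  · right
    refine key _ (mem_uIcc.2 (Or.inr ⟨?_, by linarith⟩))
    by_contra! hlt
    exact hy (hO.out m1 ⟨s, hs, rfl⟩ ⟨hlt.le, hc⟩)

section MeasureBounds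

variable {E : Set ℕ} {δ : ℝ} {μ : Measure ℝ}

lemma Mform_le_measure_closedBall (hμ : IsConformal E δ μ) (hE : 0 ∉ E) {l : List ℕ}
    (hl : PosWord l) (x r : ℝ) : Mform E μ x l r ≤ μ (closedBall x r) := by
  have hP : ∀ a ∈ E, PosWord (l ++ [a]) := fun a ha => hl.append
    (posWord_singleton (Nat.one_le_iff_ne_zero.2 fun h0 => hE (h0 ▸ ha)))
  refine (tsum_meas_le_meas_iUnion_of_disjoint₀ μ
    (As := fun a : {a : ℕ // a ∈ E ∧ cyl (l ++ [a]) ⊆ closedBall x r} => cyl (l ++ [(a : ℕ)]))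
    (fun a => (measurableSet_cyl_s10 (hP a a.2.1)).nullMeasurableSet) ?_).trans
    (measure_mono (iUnion_subset fun a => a.2.2))
  intro a b hab
  refine measure_mono_null ?_ hμ.2.1
  rintro y ⟨hya, hyb⟩ hy
  exact hab (Subtype.ext (eq_of_mem_cyl_append hE (hP a a.2.1) (hP b b.2.1) hy hya hyb))

lemma measure_le_mul_Mform (hμ : IsConformal E δ μ) {l σ : List ℕ} {x R : ℝ} {S : Set ℝ}
    {c : ℝ≥0∞} (hS : ∀ y ∈ S, y ∈ limitSet E →
      ∃ a ∈ E, y ∈ cyl (σ ++ [a]) ∧ cyl (l ++ [a]) ⊆ closedBall x R)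
    (hc : ∀ a ∈ E, μ (cyl (σ ++ [a])) ≤ c * μ (cyl (l ++ [a]))) :
    μ S ≤ c * Mform E μ x l R := by
  calc μ S ≤ μ (⋃ a : {a : ℕ // a ∈ E ∧ cyl (l ++ [a]) ⊆ closedBall x R}, cyl (σ ++ [(a : ℕ)])) := by
        refine measure_mono_ae ?_
        filter_upwards [hμ.ae_mem] with y hy hyS
        obtain ⟨a, ha, h1, h2⟩ := hS y hyS hy
        exact mem_iUnion.2 ⟨⟨a, ha, h2⟩, h1⟩
    _ ≤ ∑' a : {a : ℕ // a ∈ E ∧ cyl (l ++ [a]) ⊆ closedBall x R}, μ (cyl (σ ++ [(a : ℕ)])) :=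
        measure_iUnion_le _
    _ ≤ ∑' a : {a : ℕ // a ∈ E ∧ cyl (l ++ [a]) ⊆ closedBall x R},
          c * μ (cyl (l ++ [(a : ℕ)])) := ENNReal.tsum_le_tsum fun a => hc a a.2.1
    _ = c * Mform E μ x l R := ENNReal.tsum_mul_left

end MeasureBounds

lemma measure_closedBall_le {E : Set ℕ} {δ : ℝ} {μ : Measure ℝ} (hμ : IsConformal E δ μ)
    (hE : 0 ∉ E) (hδ : 0 ≤ δ) {l : List ℕ} (hl : l ∈ words E) {a : ℕ} (ha : a ∈ E) {x r : ℝ}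
    (hx : x ∈ cyl (l ++ [a])) (hr : 0 < r) (h1 : 32 * r * wordDen l 0 ^ 2 < 1)
    (h2 : 1 ≤ 32 * r * wordDen (l ++ [a]) 0 ^ 2) :
    μ (closedBall x r) ≤
      ENNReal.ofReal (1 + 2 * ((4 : ℝ) ^ 2) ^ δ) * Mform E μ x l (4113 * r) := by
  have hpos : ∀ b ∈ E, 1 ≤ b := fun b hb => Nat.one_le_iff_ne_zero.2 fun h0 => hE (h0 ▸ hb)
  have hP := posWord_of_mem_words hE hl
  have hPa := posWord_singleton (hpos a ha)
  have hxl := cyl_append_subset_s10 l hPa hx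
  have hq := wordDen_ge_one hP zero_mem_unit
  set κ := ENNReal.ofReal (((4 : ℝ) ^ 2) ^ δ) with hκ
  set M := Mform E μ x l (4113 * r) with hM
  -- the part of the ball inside the cylinder
  have hin : μ (closedBall x r ∩ cyl l) ≤ 1 * M := by
    refine measure_le_mul_Mform (σ := l) hμ ?_ (fun b _ => (one_mul _).ge)
    rintro y ⟨hyB, hyl⟩ hy
    obtain ⟨-, b, hb, hyb⟩ := mem_words_of_mem_cyl hE hP hy hyl
    rw [mem_closedBall', Real.dist_eq] at hyB
    exact ⟨b, hb, hyb, cyl_append_singleton_subset_closedBall hP (hpos a ha) (hpos b hb) hx hyb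
      hyB hr h1 h2⟩
  -- the part beyond the endpoint `wordMap l 0`
  have hzero : μ {y | y ∉ cyl l ∧ |x - wordMap l 0| ≤ r ∧ |y - wordMap l 0| ≤ r} ≤ κ * M := by
    obtain ⟨σ, hσP, hw, hd, hσ⟩ := exists_adjacent hP
    have hyσ : ∀ y ∈ {y | y ∉ cyl l ∧ |x - wordMap l 0| ≤ r ∧ |y - wordMap l 0| ≤ r},
        y ∈ limitSet E → y ∈ cyl σ := by
      rintro y ⟨hyl, -, hyr⟩ hy
      refine (hσ y (Ioo_subset_Icc_self (limitSet_subset hE hy)) ?_).resolve_left hyl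
      nlinarith [mul_le_mul_of_nonneg_left hyr (sq_nonneg (wordDen l 0))]
    by_cases hσE : σ ∈ words E
    · refine measure_le_mul_Mform (σ := σ) hμ ?_ (fun b hb =>
        hμ.measure_cyl_append_le hE hδ hl hσE (posWord_singleton (hpos b hb)) hd.symm)
      intro y hyS hy
      obtain ⟨-, b, hb, hyb⟩ := mem_words_of_mem_cyl hE hσP hy (hyσ y hyS hy)
      exact ⟨b, hb, hyb, (cyl_append_singleton_subset_of_adjacent hP hσP hw hd (hpos b hb)
        hyS.2.1 hyS.2.2 hyb).trans (closedBall_subset_closedBall (by linarith))⟩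
    · have hsub : {y | y ∉ cyl l ∧ |x - wordMap l 0| ≤ r ∧ |y - wordMap l 0| ≤ r} ⊆ (limitSet E)ᶜ :=
        fun y hyS hy => hσE (mem_words_of_mem_cyl hE hσP hy (hyσ y hyS hy)).1
      exact (measure_mono_null hsub hμ.2.1).le.trans zero_le
  -- the part beyond the endpoint `wordMap l 1`
  have hone : μ {y | y ∉ cyl l ∧ |x - wordMap l 1| ≤ r ∧ |y - wordMap l 1| ≤ r} ≤ κ * M := by
    by_cases hxr : |x - wordMap l 1| ≤ r
    swap
    · simp [hxr]
    obtain rfl : a = 1 := by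
      rw [cyl_append] at hx
      obtain ⟨s, hs, rfl⟩ := hx
      have hs1 := (mem_cyl_singleton (hpos a ha) hs).2
      have hs2 := abs_sub_le_wordMap hP (cyl_subset_unit hPa hs) one_mem_unit
      have hs3 : |s - 1| < 1 / 2 := by
        nlinarith [mul_le_mul_of_nonneg_left hxr (sq_nonneg (wordDen l 0))]
      have hs4 := (abs_lt.1 hs3).1
      by_contra hne
      have : 2 ≤ a := by have := hpos a ha; omega
      have h2a : (2 : ℝ) ≤ a := by exact_mod_cast this
      have : 1 / (a : ℝ) ≤ 1 / 2 := one_div_le_one_div_of_le two_pos h2a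
      linarith
    have hl1 : l ++ [1] ∈ words E := by
      intro b hb
      rcases List.mem_append.1 hb with h | h
      · exact hl b h
      · rwa [List.mem_singleton.1 h]
    obtain ⟨σ, hσP, -, hd, hσ⟩ := exists_adjacent (hP.append hPa)
    have e1 : wordMap (l ++ [1]) 0 = wordMap l 1 := by simp [wordMap_append_s10, wordMap, gaussMap]
    have e2 : wordDen (l ++ [1]) 0 = wordDen l 1 := by
      simp [wordDen_append, wordDen, wordMap, gaussMap]
    have hle := wordDen_distortion hP one_mem_unit zero_mem_unit
    have hq1 := wordDen_ge_one hP one_mem_unit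
    have hyσ : ∀ y ∈ {y | y ∉ cyl l ∧ |x - wordMap l 1| ≤ r ∧ |y - wordMap l 1| ≤ r},
        y ∈ limitSet E → y ∈ cyl σ := by
      rintro y ⟨hyl, -, hyr⟩ hy
      refine (hσ y (Ioo_subset_Icc_self (limitSet_subset hE hy)) ?_).resolve_left
        fun h => hyl (cyl_append_subset_s10 l hPa h)
      rw [e1, e2]
      have : wordDen l 1 ^ 2 ≤ (2 * wordDen l 0) ^ 2 := pow_le_pow_left₀ (by linarith) hle 2
      nlinarith [mul_le_mul this hyr (abs_nonneg _) (sq_nonneg (2 * wordDen l 0))]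
    by_cases hσE : σ ∈ words E
    · have hcyl : cyl (l ++ [1]) ⊆ closedBall x (4113 * r) :=
        cyl_append_singleton_subset_closedBall hP le_rfl le_rfl hx hx (by simpa using hr.le) hr h1 h2
      calc μ {y | y ∉ cyl l ∧ |x - wordMap l 1| ≤ r ∧ |y - wordMap l 1| ≤ r}
          ≤ μ (cyl σ) := by
            refine measure_mono_ae ?_
            filter_upwards [hμ.ae_mem] with y hy hyS using hyσ y hyS hy
        _ ≤ κ * μ (cyl (l ++ [1])) := by
            simpa using hμ.measure_cyl_append_le hE hδ hl1 hσE (m := []) (by simp [PosWord]) hd.symm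
        _ ≤ κ * M := by
            gcongr
            exact ENNReal.le_tsum (f := fun b : {b : ℕ // b ∈ E ∧
              cyl (l ++ [b]) ⊆ closedBall x (4113 * r)} => μ (cyl (l ++ [(b : ℕ)]))) ⟨1, ha, hcyl⟩
    · have hsub : {y | y ∉ cyl l ∧ |x - wordMap l 1| ≤ r ∧ |y - wordMap l 1| ≤ r} ⊆ (limitSet E)ᶜ :=
        fun y hyS hy => hσE (mem_words_of_mem_cyl hE hσP hy (hyσ y hyS hy)).1
      exact (measure_mono_null hsub hμ.2.1).le.trans zero_le
  have hcover : closedBall x r ⊆ closedBall x r ∩ cyl l ∪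
      ({y | y ∉ cyl l ∧ |x - wordMap l 0| ≤ r ∧ |y - wordMap l 0| ≤ r} ∪
        {y | y ∉ cyl l ∧ |x - wordMap l 1| ≤ r ∧ |y - wordMap l 1| ≤ r}) := by
    intro y hy
    by_cases hyl : y ∈ cyl l
    · exact Or.inl ⟨hy, hyl⟩
    · rw [mem_closedBall', Real.dist_eq] at hy
      rcases near_endpoint_of_notMem_cyl hP hxl hyl hy with h | h
      · exact Or.inr (Or.inl ⟨hyl, h⟩)
      · exact Or.inr (Or.inr ⟨hyl, h⟩)
  calc μ (closedBall x r) ≤ 1 * M + (κ * M + κ * M) :=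
        (measure_mono hcover).trans ((measure_union_le _ _).trans
          (add_le_add hin ((measure_union_le _ _).trans (add_le_add hzero hone))))
    _ = ENNReal.ofReal (1 + 2 * ((4 : ℝ) ^ 2) ^ δ) * M := by
        rw [ENNReal.ofReal_add zero_le_one (by positivity), ENNReal.ofReal_mul zero_le_two, ← hκ,
          ENNReal.ofReal_one, ENNReal.ofReal_ofNat]
        ring

/-- Global measure formula. For a regular Gauss IFS with conformal measure
`μ`, there exist `C ≥ 1` and `C' > 0` such that for all `x = π(ω) ∈ Λ_E` and `r > 0`, there is
`n` with `[ω|(n+1)] ⊆ B(x, Cr)` and `M(x,n,r) ≤ μ(B(x,r)) ≤ C' · M(x,n,Cr)`. -/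
theorem stmt10 (E : Set ℕ) (hE : 0 ∉ E) (δ : ℝ) (hδ : 0 ≤ δ) (hpress : pressure E δ = 0)
    (μ : Measure ℝ) (hμ : IsConformal E δ μ) :
    ∃ C C' : ℝ, 1 ≤ C ∧ 0 < C' ∧ ∀ ω : ℕ → ℕ, (∀ n, ω n ∈ E) → ∀ r : ℝ, 0 < r →
      ∃ n : ℕ,
        cyl (List.ofFn fun i : Fin (n + 1) => ω i) ⊆ closedBall (codingMap ω) (C * r) ∧
        Mform E μ (codingMap ω) (List.ofFn fun i : Fin n => ω i) r ≤
          μ (closedBall (codingMap ω) r) ∧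
        μ (closedBall (codingMap ω) r) ≤
          ENNReal.ofReal C' * Mform E μ (codingMap ω) (List.ofFn fun i : Fin n => ω i) (C * r) := by
  have hpos : ∀ b ∈ E, 1 ≤ b := fun b hb => Nat.one_le_iff_ne_zero.2 fun h0 => hE (h0 ▸ hb)
  refine ⟨4113, 1 + 2 * ((4 : ℝ) ^ 2) ^ δ, by norm_num, by positivity, fun ω hω r hr => ?_⟩
  have hω' : ∀ n, 1 ≤ ω n := fun n => hpos _ (hω n)
  have hprob := hμ.1
  suffices h : ∃ n, cyl (initWord ω (n + 1)) ⊆ closedBall (codingMap ω) (4113 * r) ∧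
      μ (closedBall (codingMap ω) r) ≤ ENNReal.ofReal (1 + 2 * ((4 : ℝ) ^ 2) ^ δ) *
        Mform E μ (codingMap ω) (initWord ω n) (4113 * r) by
    obtain ⟨n, h1, h2⟩ := h
    exact ⟨n, h1, Mform_le_measure_closedBall hμ hE (posWord_initWord hω' n) _ _, h2⟩
  have hex : ∃ m : ℕ, 1 ≤ 32 * r * wordDen (initWord ω m) 0 ^ 2 := by
    obtain ⟨m, hm⟩ := exists_nat_gt (1 / (32 * r))
    refine ⟨m, ?_⟩
    have h1 := length_le_wordDen (posWord_initWord hω' m) zero_mem_unit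
    have h2 := wordDen_ge_one (posWord_initWord hω' m) zero_mem_unit
    rw [length_initWord] at h1
    rw [div_lt_iff₀ (by positivity)] at hm
    nlinarith [mul_le_mul_of_nonneg_left h1 hr.le,
      mul_le_mul_of_nonneg_left (mul_self_nonneg (wordDen (initWord ω m) 0 - 1)) hr.le]
  classical
  rcases Nat.eq_zero_or_eq_succ_pred (Nat.find hex) with h0 | hs
  · refine ⟨0, ?_, ?_⟩
    all_goals
      have hr1 : 1 ≤ 32 * r := by
        have hfind := Nat.find_spec hex
        rw [h0] at hfind
        simpa [initWord, wordDen] using hfind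
      have hball : Icc (0 : ℝ) 1 ⊆ closedBall (codingMap ω) (4113 * r) := by
        intro y hy
        have hx := codingMap_mem_Icc hω'
        rw [mem_closedBall, Real.dist_eq, abs_le]
        constructor <;> linarith [hx.1, hx.2, hy.1, hy.2]
    · exact (cyl_subset_unit (posWord_initWord hω' 1)).trans hball
    · calc μ (closedBall (codingMap ω) r)
          ≤ 1 * Mform E μ (codingMap ω) (initWord ω 0) (4113 * r) := by
            refine measure_le_mul_Mform (σ := initWord ω 0) hμ ?_ (fun b _ => (one_mul _).ge)
            intro y _ hy
            have hy0 : y ∈ cyl (initWord ω 0) :=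
              ⟨y, Ioo_subset_Icc_self (limitSet_subset hE hy), by simp [initWord, wordMap]⟩
            obtain ⟨-, b, hb, hyb⟩ :=
              mem_words_of_mem_cyl hE (posWord_initWord hω' 0) hy hy0
            exact ⟨b, hb, hyb, (cyl_subset_unit ((posWord_initWord hω' 0).append
              (posWord_singleton (hpos b hb)))).trans hball⟩
        _ ≤ _ := by
            gcongr
            rw [← ENNReal.ofReal_one]
            refine ENNReal.ofReal_le_ofReal ?_
            have : (0 : ℝ) ≤ ((4 : ℝ) ^ 2) ^ δ := by positivity
            linarith
  · set n := (Nat.find hex).pred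
    have h2 := Nat.find_spec hex
    rw [hs, Nat.succ_eq_add_one] at h2
    have h1 : 32 * r * wordDen (initWord ω n) 0 ^ 2 < 1 :=
      not_le.1 (Nat.find_min hex (by omega))
    have hx := codingMap_mem_cyl hω' (n + 1)
    rw [initWord_succ] at h2 hx
    refine ⟨n, ?_, measure_closedBall_le hμ hE hδ (initWord_mem hω n) (hω n) hx hr h1 h2⟩
    rw [initWord_succ]
    exact cyl_append_singleton_subset_closedBall (posWord_initWord hω' n) (hω' n) (hω' n) hx hx
      (by simpa using hr.le) hr h1 h2
end
end
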